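/- Let 𝒜 ⊆ U₂ be a connected open subset and let φ : 𝒜 → U₂ satisfy rank(U − V) ≤ 1 ⟹ rank(φ(U) − φ(V)) ≤ 1 for all U, V ∈ 𝒜. Assume there exist A, B, C ∈ H₂ with A < C < B such that 𝔠(X) ∈ 𝒜 for every X ∈ [A,B], and such that the triple φ(𝔠(A)), φ(𝔠(C)), φ(𝔠(B)) is in a timelike position, i.e. there exists an automorphism Ψ of U₂ with Ψ(φ(𝔠(A))) = −I, Ψ(φ(𝔠(C))) = I, and Ψ(φ(𝔠(B))) = −i·I. Then φ is standard, i.e. there exists an automorphism Φ of U₂ with Φ(U) = φ(U) for every U ∈ 𝒜. -/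

import Mathlib

open Matrix
open scoped ComplexOrder

noncomputable section

/-- The space of `2×2` complex matrices. -/
abbrev Mat2 : Type := Matrix (Fin 2) (Fin 2) ℂ

/-- The group of `2×2` complex unitary matrices. -/
abbrev U2 : Type := Matrix.unitaryGroup (Fin 2) ℂ

/-- Coherency for matrices: `A ∼ B` iff `rank (A − B) ≤ 1`. -/
def Coherent (A B : Mat2) : Prop := (A - B).rank ≤ 1

/-- Coherency for unitaries: `U ∼ V` iff `rank (U − V) ≤ 1`. -/
def CoherentU (U V : U2) : Prop := ((U : Mat2) - (V : Mat2)).rank ≤ 1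

/-- The Cayley transform, as a matrix: `𝔠(A) = (A − iI)(A + iI)⁻¹`. -/
def cayleyMat (A : Mat2) : Mat2 :=
  (A - Complex.I • (1 : Mat2)) * (A + Complex.I • (1 : Mat2))⁻¹

open Classical in
/-- The Cayley transform, landing in the unitary group.  For every hermitian `A` the matrix
`cayleyMat A` is unitary, so the junk value `1` is never used for the matrices considered here. -/
def cayley (A : Mat2) : U2 :=
  if h : cayleyMat A ∈ Matrix.unitaryGroup (Fin 2) ℂ then ⟨cayleyMat A, h⟩ else 1

/-- An automorphism of `U₂`: a bijection preserving coherency in both directions. -/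
def IsAut (Φ : U2 → U2) : Prop :=
  Function.Bijective Φ ∧ ∀ U V : U2, CoherentU U V ↔ CoherentU (Φ U) (Φ V)

/-- A line in `U₂`: a maximal subset all of whose elements are pairwise coherent. -/
def IsLine (ℓ : Set U2) : Prop :=
  (∀ U ∈ ℓ, ∀ V ∈ ℓ, CoherentU U V) ∧
  ∀ m : Set U2, ℓ ⊆ m → (∀ U ∈ m, ∀ V ∈ m, CoherentU U V) → m = ℓ

/-- The matrix interval `[A, B] = {X : A ≤ X ≤ B}` (in the Loewner order). -/
def matIcc (A B : Mat2) : Set Mat2 := {X | (X - A).PosSemidef ∧ (B - X).PosSemidef}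

/-- Rank one projections: `P = P* = P²` of rank one. -/
def IsProj1 (P : Mat2) : Prop := P.IsHermitian ∧ P * P = P ∧ P.rank = 1

open Metric ComplexConjugate

/-! ### Coherency and determinants -/

lemma rank_le_one_iff_det_eq_zero (M : Mat2) : M.rank ≤ 1 ↔ M.det = 0 := by
  constructor
  · intro h
    by_contra hd
    have := Matrix.rank_of_isUnit M ((Matrix.isUnit_iff_isUnit_det M).2 (isUnit_iff_ne_zero.2 hd))
    simp at this
    omega
  · intro h
    obtain ⟨v, hv, hMv⟩ := Matrix.exists_mulVec_eq_zero_iff.2 h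
    have hker : 0 < Module.finrank ℂ (LinearMap.ker M.mulVecLin) := by
      rw [Module.finrank_pos_iff]
      exact ⟨⟨⟨v, by simpa using hMv⟩, 0, by simpa [Subtype.ext_iff] using hv⟩⟩
    have := LinearMap.finrank_range_add_finrank_ker M.mulVecLin
    simp only [Module.finrank_fintype_fun_eq_card, Fintype.card_fin] at this
    unfold Matrix.rank
    omega

lemma coherentU_iff (U V : U2) : CoherentU U V ↔ ((U : Mat2) - (V : Mat2)).det = 0 :=
  rank_le_one_iff_det_eq_zero _

lemma CoherentU.symm {U V : U2} (h : CoherentU U V) : CoherentU V U := by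
  rw [coherentU_iff] at *
  rw [← neg_sub, Matrix.det_neg, h, mul_zero]

lemma coherentU_mul_left_iff (G U V : U2) : CoherentU (G * U) (G * V) ↔ CoherentU U V := by
  have hG : (G : Mat2).det ≠ 0 := by
    intro h
    have := congrArg Matrix.det (Matrix.mem_unitaryGroup_iff.1 G.2)
    rw [Matrix.det_mul, h] at this
    simp at this
  rw [coherentU_iff, coherentU_iff]
  simp only [Submonoid.coe_mul, ← mul_sub, Matrix.det_mul, mul_eq_zero, hG, false_or]

/-! ### Spectral form of a unitary matrix -/

/-- The unit sphere of `ℝ³`, which parametrizes the rank one projections. -/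
abbrev S2 : Type := sphere (0 : EuclideanSpace ℝ (Fin 3)) 1

lemma S2.sum_sq (n : S2) : n.1 0 ^ 2 + n.1 1 ^ 2 + n.1 2 ^ 2 = 1 := by
  have h := (EuclideanSpace.sphere_zero_eq (n := Fin 3) 1 zero_le_one).subset n.2
  simpa [Fin.sum_univ_three] using h

/-- The point of the sphere with the given coordinates. -/
def S2.mk (x y z : ℝ) (h : x ^ 2 + y ^ 2 + z ^ 2 = 1) : S2 :=
  ⟨!₂[x, y, z], by
    rw [EuclideanSpace.sphere_zero_eq _ zero_le_one]
    simpa [Fin.sum_univ_three] using h⟩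

lemma S2.ext {n m : S2} (h0 : n.1 0 = m.1 0) (h1 : n.1 1 = m.1 1) (h2 : n.1 2 = m.1 2) :
    n = m := by
  apply Subtype.ext
  ext i
  fin_cases i <;> assumption

/-- The trace of the product of the projections belonging to `n` and `m`. -/
def overlap (n m : S2) : ℝ := (1 + n.1 0 * m.1 0 + n.1 1 * m.1 1 + n.1 2 * m.1 2) / 2

lemma overlap_neg_right (n m : S2) : overlap n (-m) = 1 - overlap n m := by
  simp [overlap]
  ring

lemma overlap_nonneg (n m : S2) : 0 ≤ overlap n m := by
  unfold overlap
  nlinarith [n.sum_sq, m.sum_sq, sq_nonneg (n.1 0 + m.1 0), sq_nonneg (n.1 1 + m.1 1),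
    sq_nonneg (n.1 2 + m.1 2)]

lemma overlap_le_one (n m : S2) : overlap n m ≤ 1 := by
  have := overlap_nonneg n (-m)
  rw [overlap_neg_right] at this
  linarith

lemma eq_of_overlap_eq_one {n m : S2} (h : overlap n m = 1) : n = m := by
  have e : (n.1 0 - m.1 0) ^ 2 + (n.1 1 - m.1 1) ^ 2 + (n.1 2 - m.1 2) ^ 2 = 0 := by
    unfold overlap at h
    linear_combination n.sum_sq + m.sum_sq - 4 * h
  apply S2.ext <;>
  nlinarith [sq_nonneg (n.1 0 - m.1 0), sq_nonneg (n.1 1 - m.1 1), sq_nonneg (n.1 2 - m.1 2)]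

lemma eq_neg_of_overlap_eq_zero {n m : S2} (h : overlap n m = 0) : n = -m :=
  eq_of_overlap_eq_one (by rw [overlap_neg_right, h, sub_zero])

/-- The matrix `z P + w (1 - P)`, where `P` is the rank one projection belonging to `n`. -/
def specMat (n : S2) (z w : ℂ) : Mat2 :=
  !![((z + w) + (z - w) * n.1 2) / 2, (z - w) * (n.1 0 - Complex.I * n.1 1) / 2;
    (z - w) * (n.1 0 + Complex.I * n.1 1) / 2, ((z + w) - (z - w) * n.1 2) / 2]

lemma S2.sum_sq_complex (n : S2) : (n.1 0 : ℂ) ^ 2 + (n.1 1 : ℂ) ^ 2 + (n.1 2 : ℂ) ^ 2 = 1 := by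
  have h := congrArg (fun x : ℝ => (x : ℂ)) n.sum_sq
  simpa only [Complex.ofReal_add, Complex.ofReal_pow, Complex.ofReal_one] using h

lemma specMat_mul (n : S2) (z w u v : ℂ) :
    specMat n z w * specMat n u v = specMat n (z * u) (w * v) := by
  have h := n.sum_sq_complex
  have hI := Complex.I_sq
  ext i j
  fin_cases i <;> fin_cases j <;> simp [specMat, Matrix.mul_apply, Fin.sum_univ_two]
  · linear_combination (z - w) * (u - v) / 4 * h - (n.1 1) ^ 2 * (z - w) * (u - v) / 4 * hI
  · ring
  · ring
  · linear_combination (z - w) * (u - v) / 4 * h - (n.1 1) ^ 2 * (z - w) * (u - v) / 4 * hI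

lemma star_specMat (n : S2) (z w : ℂ) : star (specMat n z w) = specMat n (conj z) (conj w) := by
  ext i j
  fin_cases i <;> fin_cases j <;> simp [specMat, Matrix.star_apply, sub_eq_add_neg]

lemma specMat_self (n : S2) (z : ℂ) : specMat n z z = z • (1 : Mat2) := by
  ext i j
  fin_cases i <;> fin_cases j <;> simp [specMat]

lemma det_specMat_sub (n m : S2) (z w u v : ℂ) :
    (specMat n z w - specMat m u v).det =
      overlap n m * ((z - u) * (w - v)) + (1 - overlap n m) * ((z - v) * (w - u)) := by
  have h := n.sum_sq_complex
  have h' := m.sum_sq_complex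
  have hI := Complex.I_sq
  simp only [specMat, Matrix.det_fin_two, overlap]
  simp
  linear_combination (-(z - w) ^ 2 / 4) * h + (-(u - v) ^ 2 / 4) * h'
    + ((z - w) * n.1 1 - (u - v) * m.1 1) ^ 2 / 4 * hI

/-- The unitary `z P + w (1 - P)`, where `P` is the rank one projection belonging to `n`. -/
def spec (n : S2) (z w : Circle) : U2 :=
  ⟨specMat n z w, by
    rw [Matrix.mem_unitaryGroup_iff, star_specMat, specMat_mul, Complex.mul_conj,
      Complex.mul_conj]
    simp [specMat_self]⟩

lemma coe_spec (n : S2) (z w : Circle) : (spec n z w : Mat2) = specMat n z w := rfl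

lemma coherentU_spec (n m : S2) (z w u v : Circle) :
    CoherentU (spec n z w) (spec m u v) ↔
      (overlap n m : ℂ) * (((z : ℂ) - u) * ((w : ℂ) - v))
        + (1 - overlap n m) * (((z : ℂ) - v) * ((w : ℂ) - u)) = 0 := by
  rw [coherentU_iff, coe_spec, coe_spec, det_specMat_sub]

lemma Circle.coe_sub_eq_zero {z w : Circle} : (z : ℂ) - w = 0 ↔ z = w := by
  rw [sub_eq_zero, Circle.coe_inj]

lemma overlap_self (n : S2) : overlap n n = 1 := by
  unfold overlap
  linear_combination n.sum_sq / 2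

lemma coherentU_spec_self (n : S2) (z w u v : Circle) :
    CoherentU (spec n z w) (spec n u v) ↔ z = u ∨ w = v := by
  rw [coherentU_spec, overlap_self]
  simp [Circle.coe_sub_eq_zero]

lemma spec_neg (n : S2) (z w : Circle) : spec (-n) z w = spec n w z := by
  apply Subtype.ext
  ext i j
  fin_cases i <;> fin_cases j <;> simp [coe_spec, specMat] <;> ring

lemma spec_self_eq (n m : S2) (z : Circle) : spec n z z = spec m z z :=
  Subtype.ext (by simp [coe_spec, specMat_self])

lemma spec_one_one (n : S2) : spec n 1 1 = 1 :=
  Subtype.ext (by simp [coe_spec, specMat_self])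

lemma spec_trace_det (n : S2) (z w : ℂ) :
    (specMat n z w).trace = z + w ∧ (specMat n z w).det = z * w := by
  constructor
  · simp [specMat, Matrix.trace_fin_two]
    ring
  · have h := n.sum_sq_complex
    have hI := Complex.I_sq
    simp [specMat, Matrix.det_fin_two]
    linear_combination (-(z - w) ^ 2 / 4) * h + ((z - w) * n.1 1) ^ 2 / 4 * hI

lemma spec_eq_spec {n m : S2} {z w u v : Circle} (h : spec n z w = spec m u v) :
    (z = u ∧ w = v ∧ (n = m ∨ z = w)) ∨ (z = v ∧ w = u ∧ (n = -m ∨ z = w)) := by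
  have hM : specMat n z w = specMat m u v := congrArg Subtype.val h
  have ht : (z : ℂ) + w = u + v := by
    rw [← (spec_trace_det n z w).1, ← (spec_trace_det m u v).1, hM]
  have hd : (z : ℂ) * w = u * v := by
    rw [← (spec_trace_det n z w).2, ← (spec_trace_det m u v).2, hM]
  have hzz : ((z : ℂ) - u) * (z - v) = 0 := by linear_combination z * ht - hd
  have hov : ∀ k : S2, ∀ a b : Circle, spec n z w = spec k a b → z = a → w = b → n = k ∨ z = w := by
    rintro k a b hk rfl rfl
    have hM : specMat n z w = specMat k z w := congrArg Subtype.val hk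
    by_cases hzw : z = w
    · exact Or.inr hzw
    left
    have hzw' : (z : ℂ) - w ≠ 0 := fun h => hzw (Circle.coe_sub_eq_zero.1 h)
    have h2 := congrFun (congrFun hM 0) 0
    have h01 := congrFun (congrFun hM 0) 1
    have h10 := congrFun (congrFun hM 1) 0
    simp [specMat] at h2 h01 h10
    have e0 : (n.1 0 : ℂ) = k.1 0 := by
      rcases h01 with h01 | h01
      swap
      · exact absurd h01 hzw'
      rcases h10 with h10 | h10
      swap
      · exact absurd h10 hzw'
      linear_combination (h01 + h10) / 2
    have e1 : (n.1 1 : ℂ) = k.1 1 := by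
      rcases h01 with h01 | h01
      swap
      · exact absurd h01 hzw'
      rcases h10 with h10 | h10
      swap
      · exact absurd h10 hzw'
      apply mul_left_cancel₀ Complex.I_ne_zero
      linear_combination (h10 - h01) / 2
    exact S2.ext (by exact_mod_cast e0) (by exact_mod_cast e1) (h2.resolve_right hzw')
  rcases mul_eq_zero.1 hzz with h1 | h1
  · left
    have hz : z = u := Circle.coe_sub_eq_zero.1 h1
    have hw : w = v := by
      subst hz
      exact Circle.ext (add_left_cancel ht)
    exact ⟨hz, hw, hov m u v h hz hw⟩
  · right
    have hz : z = v := Circle.coe_sub_eq_zero.1 h1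
    have hw : w = u := by
      subst hz
      apply Circle.ext
      linear_combination ht
    exact ⟨hz, hw, hov (-m) v u (by rw [h, spec_neg]) hz hw⟩

lemma spec_eq_spec_same {n : S2} {z w u v : Circle} (h : spec n z w = spec n u v) :
    z = u ∧ w = v := by
  rcases spec_eq_spec h with ⟨h1, h2, -⟩ | ⟨h1, h2, h3⟩
  · exact ⟨h1, h2⟩
  · rcases h3 with h3 | h3
    · exact absurd h3 (ne_neg_of_mem_unit_sphere ℝ n)
    · exact ⟨h3.trans h2, h3.symm.trans h1⟩

/-- The point of the unit circle given by a complex number of norm one. -/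
def Circle.mk (z : ℂ) (h : ‖z‖ = 1) : Circle := ⟨z, mem_sphere_zero_iff_norm.2 h⟩

lemma exists_polar (x y z : ℝ) : ∃ (r : ℝ) (n : S2), r ^ 2 = x ^ 2 + y ^ 2 + z ^ 2 ∧
    r * n.1 0 = x ∧ r * n.1 1 = y ∧ r * n.1 2 = z := by
  have h0 : 0 ≤ x ^ 2 + y ^ 2 + z ^ 2 := by positivity
  have hr : √(x ^ 2 + y ^ 2 + z ^ 2) ^ 2 = x ^ 2 + y ^ 2 + z ^ 2 := Real.sq_sqrt h0
  set r := √(x ^ 2 + y ^ 2 + z ^ 2)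
  by_cases hr0 : r = 0
  · rw [hr0] at hr
    refine ⟨0, S2.mk 1 0 0 (by norm_num), hr, ?_, ?_, ?_⟩ <;>
    nlinarith [sq_nonneg x, sq_nonneg y, sq_nonneg z]
  · refine ⟨r, S2.mk (x / r) (y / r) (z / r) ?_, hr, ?_, ?_, ?_⟩
    · field_simp
      exact hr.symm
    all_goals
      simp [S2.mk]
      field_simp

lemma exists_spec (U : U2) : ∃ (n : S2) (z w : Circle), U = spec n z w := by
  obtain ⟨d, hd⟩ := IsAlgClosed.exists_pow_nat_eq (U : Mat2).det (n := 2) (by norm_num)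
  have hU := Matrix.mem_unitaryGroup_iff'.1 U.2
  have hDD : conj (U : Mat2).det * (U : Mat2).det = 1 := by
    have := congrArg Matrix.det hU
    rwa [Matrix.det_mul, Matrix.star_eq_conjTranspose, Matrix.det_conjTranspose,
      Matrix.det_one] at this
  have hadj : (U : Mat2).adjugate = (U : Mat2).det • star (U : Mat2) := by
    calc (U : Mat2).adjugate = star (U : Mat2) * U * (U : Mat2).adjugate := by rw [hU, one_mul]
      _ = _ := by rw [mul_assoc, Matrix.mul_adjugate, mul_smul_comm, mul_one]
  have hdd : conj d * d = 1 := by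
    rw [← hd, map_pow, ← mul_pow, ← Complex.normSq_eq_conj_mul_self] at hDD
    rw [← Complex.normSq_eq_conj_mul_self]
    norm_cast at hDD ⊢
    exact (pow_eq_one_iff_of_nonneg (Complex.normSq_nonneg d) two_ne_zero).1 hDD
  rw [Matrix.adjugate_fin_two] at hadj
  have h11 : (U : Mat2) 1 1 = (U : Mat2).det * conj ((U : Mat2) 0 0) := by
    simpa [Matrix.star_apply] using congrFun (congrFun hadj 0) 0
  have h01 : -(U : Mat2) 0 1 = (U : Mat2).det * conj ((U : Mat2) 1 0) := by
    simpa [Matrix.star_apply] using congrFun (congrFun hadj 0) 1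
  have hdet := Matrix.det_fin_two (U : Mat2)
  set a := (U : Mat2) 0 0 with ha
  set c := (U : Mat2) 1 0 with hc
  rw [← hd] at h11 h01 hdet
  obtain ⟨r, n, hr, hx, hy, hz⟩ := exists_polar (conj d * c).im (-(conj d * c).re) (conj d * a).im
  have hs : ((conj d * a).re : ℂ) + (conj d * a).im * Complex.I = conj d * a := Complex.re_add_im _
  have ht : ((conj d * c).re : ℂ) + (conj d * c).im * Complex.I = conj d * c := Complex.re_add_im _
  have hs' : ((conj d * a).re : ℂ) - (conj d * a).im * Complex.I = d * conj a := by
    have := congrArg conj hs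
    simpa [sub_eq_add_neg] using this
  have ht' : ((conj d * c).re : ℂ) - (conj d * c).im * Complex.I = d * conj c := by
    have := congrArg conj ht
    simpa [sub_eq_add_neg] using this
  generalize (conj d * a).re = a0 at *
  generalize (conj d * a).im = b3 at *
  generalize (conj d * c).re = t0 at *
  generalize (conj d * c).im = t1 at *
  have hd0 : d ≠ 0 := by
    rintro rfl
    simp at hdd
  have hnorm : (a0 : ℂ) ^ 2 + (r : ℂ) ^ 2 = 1 := by
    have hr' : (r : ℂ) ^ 2 = t1 ^ 2 + t0 ^ 2 + b3 ^ 2 := by exact_mod_cast (by simpa using hr)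
    have e1 : (a0 : ℂ) ^ 2 + b3 ^ 2 = a * conj a := by
      linear_combination (a0 - b3 * Complex.I) * hs + conj d * a * hs' + a * conj a * hdd
        + b3 ^ 2 * Complex.I_sq
    have e2 : (t0 : ℂ) ^ 2 + t1 ^ 2 = c * conj c := by
      linear_combination (t0 - t1 * Complex.I) * ht + conj d * c * ht' + c * conj c * hdd
        + t1 ^ 2 * Complex.I_sq
    have e3 : d ^ 2 * (a * conj a + c * conj c) = d ^ 2 * 1 := by
      linear_combination -hdet - a * h11 - c * h01
    have := mul_left_cancel₀ (pow_ne_zero 2 hd0) e3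
    linear_combination hr' + e1 + e2 + this
  have hnd : ‖d‖ = 1 := by
    have : Complex.normSq d = 1 := by
      rw [← Complex.normSq_eq_conj_mul_self] at hdd
      exact_mod_cast hdd
    rw [Complex.normSq_eq_norm_sq] at this
    exact (pow_eq_one_iff_of_nonneg (norm_nonneg d) two_ne_zero).1 this
  have hreal : a0 ^ 2 + r ^ 2 = 1 := by exact_mod_cast hnorm
  have hn1 : ‖(a0 : ℂ) + r * Complex.I‖ = 1 := by
    rw [Complex.norm_add_mul_I, hreal, Real.sqrt_one]
  have hn2 : ‖(a0 : ℂ) + (-r : ℝ) * Complex.I‖ = 1 := by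
    rw [Complex.norm_add_mul_I, neg_sq, hreal, Real.sqrt_one]
  have hx' : (r : ℂ) * n.1 0 = t1 := by rw [← hx]; simp
  have hy' : (r : ℂ) * n.1 1 = -t0 := by rw [← Complex.ofReal_neg, ← hy]; simp
  have hz' : (r : ℂ) * n.1 2 = b3 := by rw [← hz]; simp
  refine ⟨n, Circle.mk (d * (a0 + r * Complex.I)) (by rw [norm_mul, hnd, hn1, one_mul]),
    Circle.mk (d * (a0 + (-r : ℝ) * Complex.I)) (by rw [norm_mul, hnd, hn2, one_mul]), ?_⟩
  have hda : d * (a0 + b3 * Complex.I) = a := by linear_combination d * hs + a * hdd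
  have hdc : d * (t0 + t1 * Complex.I) = c := by linear_combination d * ht + c * hdd
  apply Subtype.ext
  rw [coe_spec]
  ext i j
  fin_cases i <;> fin_cases j <;> simp [Circle.mk, specMat]
  · rw [← ha]
    linear_combination -hda - d * Complex.I * hz'
  · linear_combination -h01 + d * ht' - d * Complex.I * hx' + d * hy' * Complex.I ^ 2
      - t0 * d * Complex.I_sq
  · rw [← hc]
    linear_combination -hdc - d * Complex.I * hx' - d * hy' * Complex.I ^ 2
      + t0 * d * Complex.I_sq
  · linear_combination h11 - d * hs' + d * Complex.I * hz'

lemma Circle.eq_of_convex_combination {w u v : Circle} {p : ℝ} (h0 : 0 ≤ p) (h1 : p ≤ 1)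
    (h : (w : ℂ) = p * v + (1 - p) * u) : p = 0 ∨ p = 1 ∨ u = v := by
  by_contra! hne
  obtain ⟨hp0, hp1, huv⟩ := hne
  have := (strictConvex_closedBall ℝ (0 : ℂ) 1) (x := (v : ℂ))
    (mem_closedBall_zero_iff.2 v.norm_coe.le) (y := (u : ℂ))
    (mem_closedBall_zero_iff.2 u.norm_coe.le)
    (fun h => huv (Circle.ext h.symm)) (lt_of_le_of_ne h0 hp0.symm)
    (sub_pos.2 (lt_of_le_of_ne h1 hp1)) (by ring)
  rw [interior_closedBall _ one_ne_zero] at this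
  have hw : ‖(w : ℂ)‖ < 1 := by simpa [← h] using this
  exact hw.ne w.norm_coe

/-- A unitary coherent with two points of a line lies on that line. -/
lemma exists_eq_spec_of_coherentU {U : U2} {m : S2} {z z' w : Circle} (hz : z ≠ z')
    (h : CoherentU U (spec m z w)) (h' : CoherentU U (spec m z' w)) :
    ∃ u : Circle, U = spec m u w := by
  obtain ⟨k, u, v, rfl⟩ := exists_spec U
  rw [coherentU_spec] at h h'
  have hz' : (z : ℂ) - z' ≠ 0 := fun e => hz (Circle.coe_sub_eq_zero.1 e)
  have hw : (w : ℂ) = overlap k m * v + (1 - overlap k m) * u := by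
    apply mul_left_cancel₀ hz'
    linear_combination h - h'
  rcases Circle.eq_of_convex_combination (overlap_nonneg k m) (overlap_le_one k m) hw with hp | hp | hp
  · have := eq_neg_of_overlap_eq_zero hp
    subst this
    rw [hp] at hw
    have : w = u := Circle.ext (by simpa using hw)
    exact ⟨v, by rw [spec_neg, this]⟩
  · have := eq_of_overlap_eq_one hp
    subst this
    rw [hp] at hw
    have : w = v := Circle.ext (by simpa using hw)
    exact ⟨u, by rw [this]⟩
  · subst hp
    have : w = u := Circle.ext (by linear_combination hw)
    exact ⟨u, by rw [this]; exact spec_self_eq _ _ _⟩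

/-! ### Propagation along light cones -/

lemma continuous_spec : Continuous fun x : S2 × Circle × Circle => spec x.1 x.2.1 x.2.2 := by
  apply Continuous.subtype_mk
  apply continuous_matrix
  intro i j
  fin_cases i <;> fin_cases j <;> simp [specMat] <;> fun_prop

instance : ConnectedSpace S2 :=
  Subtype.connectedSpace (isConnected_sphere
    (by rw [← Module.finrank_eq_rank]; simp) 0 zero_le_one)

instance : Nontrivial Circle :=
  ⟨1, -1, (Circle.neg_ne_self 1).symm⟩

instance : Nontrivial S2 :=
  ⟨S2.mk 1 0 0 (by norm_num), -S2.mk 1 0 0 (by norm_num), ne_neg_of_mem_unit_sphere ℝ _⟩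

open Topology Filter in
/-- If a coherency preserver fixes an open set pointwise, then it fixes every point coherent
with some point of that set. -/
lemma eq_self_of_coherentU {𝒜 W : Set U2} {ψ : U2 → U2}
    (hψ : ∀ U ∈ 𝒜, ∀ V ∈ 𝒜, CoherentU U V → CoherentU (ψ U) (ψ V))
    (hW : IsOpen W) (hW𝒜 : W ⊆ 𝒜) (hid : ∀ U ∈ W, ψ U = U)
    {Y V : U2} (hY : Y ∈ 𝒜) (hV : V ∈ W) (h : CoherentU Y V) : ψ Y = Y := by
  have hcoh : ∀ n z, Y * spec n z 1 ∈ W → CoherentU (Y⁻¹ * ψ Y) (spec n z 1) := by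
    intro n z hmem
    have hc : CoherentU Y (Y * spec n z 1) := by
      rw [← coherentU_mul_left_iff Y⁻¹, inv_mul_cancel, inv_mul_cancel_left, ← spec_one_one n,
        coherentU_spec_self]
      exact Or.inr rfl
    have := hψ _ hY _ (hW𝒜 hmem) hc
    rwa [hid _ hmem, ← coherentU_mul_left_iff Y⁻¹, inv_mul_cancel_left] at this
  have hline : ∀ n z, Y * spec n z 1 ∈ W → ∃ u, Y⁻¹ * ψ Y = spec n u 1 := by
    intro n z hmem
    have hcont : Continuous fun z : Circle => Y * spec n z 1 :=
      continuous_const.mul (continuous_spec.comp (f := fun z : Circle => (n, z, (1 : Circle)))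
        (by fun_prop))
    have hnear : ∀ᶠ z' in 𝓝[≠] z, Y * spec n z' 1 ∈ W ∧ z' ≠ z :=
      (((hcont.tendsto z).eventually (hW.mem_nhds hmem)).filter_mono nhdsWithin_le_nhds).and
        self_mem_nhdsWithin
    obtain ⟨z', hz', hne⟩ := hnear.exists
    exact exists_eq_spec_of_coherentU hne (hcoh n z' hz') (hcoh n z hmem)
  obtain ⟨n, z, hnz⟩ : ∃ n z, Y⁻¹ * V = spec n z 1 := by
    obtain ⟨n, z, w, hs⟩ := exists_spec (Y⁻¹ * V)
    have h1 : CoherentU (spec n z w) (spec n 1 1) := by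
      rw [← hs, spec_one_one, ← coherentU_mul_left_iff Y]
      simpa using h.symm
    rcases (coherentU_spec_self _ _ _ _ _).1 h1 with rfl | rfl
    · exact ⟨-n, w, by rw [hs, spec_neg]⟩
    · exact ⟨n, z, hs⟩
  have hmem : Y * spec n z 1 ∈ W := by rwa [← hnz, mul_inv_cancel_left]
  have hcont : Continuous fun n : S2 => Y * spec n z 1 :=
    continuous_const.mul (continuous_spec.comp (f := fun n : S2 => (n, z, (1 : Circle)))
      (by fun_prop))
  have hnear : ∀ᶠ n' in 𝓝[≠] n, (Y * spec n' z 1 ∈ W ∧ n' ≠ -n) ∧ n' ≠ n :=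
    ((((hcont.tendsto n).eventually (hW.mem_nhds hmem)).and
      (isOpen_ne.mem_nhds (ne_neg_of_mem_unit_sphere ℝ n))).filter_mono nhdsWithin_le_nhds).and
        self_mem_nhdsWithin
  obtain ⟨n', ⟨hn', hneg⟩, hne⟩ := hnear.exists
  obtain ⟨u, hu⟩ := hline n z hmem
  obtain ⟨u', hu'⟩ := hline n' z hn'
  have hone : Y⁻¹ * ψ Y = 1 := by
    rcases spec_eq_spec (hu'.symm.trans hu) with ⟨-, -, h3 | h3⟩ | ⟨-, -, h3 | h3⟩
    · exact absurd h3 hne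
    · rw [hu', h3, spec_one_one]
    · exact absurd h3 hneg
    · rw [hu', h3, spec_one_one]
  exact (inv_mul_eq_one.1 hone).symm

open Topology Filter in
/-- A coherency preserver on a connected open set which is the identity on some nonempty open
subset is the identity. -/
lemma eq_self_of_eq_self_on_open {𝒜 W₀ : Set U2} {ψ : U2 → U2} (hopen : IsOpen 𝒜)
    (hconn : IsPreconnected 𝒜)
    (hψ : ∀ U ∈ 𝒜, ∀ V ∈ 𝒜, CoherentU U V → CoherentU (ψ U) (ψ V))
    (hW₀ : IsOpen W₀) (hne : W₀.Nonempty) (hsub : W₀ ⊆ 𝒜) (hid : ∀ U ∈ W₀, ψ U = U) :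
    ∀ U ∈ 𝒜, ψ U = U := by
  set W := interior {U | U ∈ 𝒜 ∧ ψ U = U} with hWdef
  have hWo : IsOpen W := isOpen_interior
  have hW𝒜 : W ⊆ 𝒜 := fun U hU => (interior_subset hU).1
  have hWid : ∀ U ∈ W, ψ U = U := fun U hU => (interior_subset hU).2
  have hW₀W : W₀ ⊆ W := interior_maximal (fun U hU => ⟨hsub hU, hid U hU⟩) hW₀
  have hcone : ∀ Y ∈ 𝒜, ∀ V ∈ W, CoherentU Y V → Y ∈ W := by
    intro Y hY V hV hYV
    rw [hWdef, mem_interior_iff_mem_nhds]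
    have hcont : Continuous fun Z : U2 => Z * (Y⁻¹ * V) := continuous_id.mul continuous_const
    have hVn : ∀ᶠ Z in 𝓝 Y, Z * (Y⁻¹ * V) ∈ W :=
      (hcont.tendsto Y).eventually (hWo.mem_nhds (by simpa using hV))
    filter_upwards [hVn, hopen.mem_nhds hY] with Z hZ hZ𝒜
    refine ⟨hZ𝒜, eq_self_of_coherentU hψ hWo hW𝒜 hWid hZ𝒜 hZ ?_⟩
    rw [← coherentU_mul_left_iff Z⁻¹, inv_mul_cancel, inv_mul_cancel_left,
      ← coherentU_mul_left_iff Y]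
    simpa using hYV
  have hclosed : closure W ∩ 𝒜 ⊆ W := by
    rintro X ⟨hXcl, hX⟩
    set K : Set (S2 × Circle × Circle) := {x | X * spec x.1 x.2.1 1 ∈ 𝒜ᶜ} with hK
    have hKc : IsClosed K := by
      refine hopen.isClosed_compl.preimage (continuous_const.mul (continuous_spec.comp
        (f := fun x : S2 × Circle × Circle => (x.1, x.2.1, (1 : Circle))) (by fun_prop)))
    have hKi : IsClosed ((fun x : S2 × Circle × Circle => spec x.1 x.2.1 x.2.2) '' K) :=
      (hKc.isCompact.image continuous_spec).isClosed
    have hN : (fun V => X⁻¹ * V) ⁻¹' ((fun x : S2 × Circle × Circle =>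
        spec x.1 x.2.1 x.2.2) '' K)ᶜ ∈ 𝓝 X := by
      apply (hKi.isOpen_compl.preimage (continuous_const.mul continuous_id)).mem_nhds
      rintro ⟨⟨n, a, b⟩, hmem, heq⟩
      replace heq : spec n a b = X⁻¹ * X := heq
      rw [inv_mul_cancel, ← spec_one_one n] at heq
      obtain ⟨rfl, -⟩ := spec_eq_spec_same heq
      simp only [hK, Set.mem_ofPred_eq, spec_one_one, mul_one] at hmem
      exact hmem hX
    obtain ⟨V, hVN, hVW⟩ := mem_closure_iff_nhds.1 hXcl _ hN
    obtain ⟨n, a, b, hs⟩ := exists_spec (X⁻¹ * V)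
    have hZ : X * spec n a 1 ∈ 𝒜 := by
      by_contra hnot
      exact hVN ⟨(n, a, b), hnot, hs.symm⟩
    have hZW : X * spec n a 1 ∈ W := by
      refine hcone _ hZ V hVW ?_
      rw [← coherentU_mul_left_iff X⁻¹, inv_mul_cancel_left, hs, coherentU_spec_self]
      exact Or.inl rfl
    refine hcone X hX _ hZW ?_
    rw [← coherentU_mul_left_iff X⁻¹, inv_mul_cancel_left, inv_mul_cancel, ← spec_one_one n,
      coherentU_spec_self]
    exact Or.inr rfl
  obtain ⟨U₀, hU₀⟩ := hne
  have := hconn.subset_of_closure_inter_subset hWo ⟨U₀, hsub hU₀, hW₀W hU₀⟩ hclosed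
  exact fun U hU => hWid U (this hU)

/-! ### Coherency preservers on the standard matrix interval -/

/-- The unit complex number `-i`. -/
def Circle.negI : Circle := Circle.mk (-Complex.I) (by simp)

lemma Circle.coe_negI : (Circle.negI : ℂ) = -Complex.I := rfl

/-- The closed lower half of the unit circle. -/
def lowerArc : Set Circle := {z | (z : ℂ).im ≤ 0}

lemma one_mem_lowerArc : (1 : Circle) ∈ lowerArc := by simp [lowerArc]

lemma neg_one_mem_lowerArc : (-1 : Circle) ∈ lowerArc := by simp [lowerArc]

lemma negI_mem_lowerArc : Circle.negI ∈ lowerArc := by simp [lowerArc, Circle.coe_negI]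

/-- `θ` preserves coherency on the unitaries with spectrum in the closed lower half circle and
fixes the scalar matrices `1`, `-1` and `-i`. -/
structure IsNormalized (θ : U2 → U2) : Prop where
  coherent : ∀ (n m : S2), ∀ z ∈ lowerArc, ∀ w ∈ lowerArc, ∀ u ∈ lowerArc, ∀ v ∈ lowerArc,
    CoherentU (spec n z w) (spec m u v) → CoherentU (θ (spec n z w)) (θ (spec m u v))
  map_one : ∀ n, θ (spec n 1 1) = spec n 1 1
  map_neg_one : ∀ n, θ (spec n (-1) (-1)) = spec n (-1) (-1)
  map_negI : ∀ n, θ (spec n Circle.negI Circle.negI) = spec n Circle.negI Circle.negI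

lemma Circle.neg_one_ne_one : (-1 : Circle) ≠ 1 := Circle.neg_ne_self 1

lemma Circle.negI_ne_one : Circle.negI ≠ 1 := fun h => by
  have := congrArg (fun z : Circle => (z : ℂ).re) h
  simp [Circle.coe_negI] at this

lemma Circle.negI_ne_neg_one : Circle.negI ≠ -1 := fun h => by
  have := congrArg (fun z : Circle => (z : ℂ).re) h
  simp [Circle.coe_negI] at this

/-- A unitary on two lines with the same eigenprojections is determined by the fixed
eigenvalues. -/
lemma eq_spec_of_mem_lines {U : U2} {n : S2} {a b u v : Circle} (h : U = spec n a u)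
    (h' : U = spec n v b) : U = spec n a b := by
  obtain ⟨rfl, rfl⟩ := spec_eq_spec_same (h.symm.trans h')
  exact h

namespace IsNormalized

variable {θ : U2 → U2}

lemma exists_map_reflection (hθ : IsNormalized θ) (n : S2) :
    ∃ m, θ (spec n 1 (-1)) = spec m 1 (-1) := by
  have h1 := hθ.coherent n n 1 one_mem_lowerArc (-1) neg_one_mem_lowerArc 1 one_mem_lowerArc
    1 one_mem_lowerArc ((coherentU_spec_self _ _ _ _ _).2 (Or.inl rfl))
  have h2 := hθ.coherent n n 1 one_mem_lowerArc (-1) neg_one_mem_lowerArc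
    (-1) neg_one_mem_lowerArc (-1) neg_one_mem_lowerArc
    ((coherentU_spec_self _ _ _ _ _).2 (Or.inr rfl))
  obtain ⟨m, a, b, h⟩ := exists_spec (θ (spec n 1 (-1)))
  rw [hθ.map_one, spec_self_eq n m, h, coherentU_spec_self] at h1
  rw [hθ.map_neg_one, spec_self_eq n m, h, coherentU_spec_self] at h2
  have hne := Circle.neg_one_ne_one
  rcases h1 with rfl | rfl <;> rcases h2 with h2 | h2
  · exact absurd h2.symm hne
  · exact ⟨m, by rw [h, h2]⟩
  · subst h2
    exact ⟨-m, by rw [h, spec_neg]⟩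
  · exact absurd h2.symm hne

lemma exists_spectral_maps (hθ : IsNormalized θ) :
    ∃ (f : S2 → S2) (g : S2 → Circle → Circle), (∀ n, f (-n) = -f n) ∧
      (∀ n, g n 1 = 1 ∧ g n (-1) = -1 ∧ g n Circle.negI = Circle.negI) ∧
      ∀ n, ∀ z ∈ lowerArc, ∀ w ∈ lowerArc,
        θ (spec n z w) = spec (f n) (g n z) (g (-n) w) := by
  have hk := one_mem_lowerArc
  have hk' := neg_one_mem_lowerArc
  have hki := negI_mem_lowerArc
  have hne := Circle.neg_one_ne_one
  choose f hf using hθ.exists_map_reflection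
  have hlow : ∀ n, ∀ z ∈ lowerArc, ∃ u, θ (spec n z (-1)) = spec (f n) u (-1) := by
    intro n z hz
    have h1 := hθ.coherent n n z hz _ hk' _ hk _ hk'
      ((coherentU_spec_self _ _ _ _ _).2 (Or.inr rfl))
    have h2 := hθ.coherent n n z hz _ hk' _ hk' _ hk'
      ((coherentU_spec_self _ _ _ _ _).2 (Or.inr rfl))
    rw [hf] at h1
    rw [hθ.map_neg_one, spec_self_eq n (f n)] at h2
    exact exists_eq_spec_of_coherentU hne.symm h1 h2
  have hupp : ∀ n, ∀ w ∈ lowerArc, ∃ u, θ (spec n 1 w) = spec (f n) 1 u := by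
    intro n w hw
    have h1 := hθ.coherent n n _ hk w hw _ hk _ hk'
      ((coherentU_spec_self _ _ _ _ _).2 (Or.inl rfl))
    have h2 := hθ.coherent n n _ hk w hw _ hk _ hk
      ((coherentU_spec_self _ _ _ _ _).2 (Or.inl rfl))
    rw [hf, ← spec_neg (f n)] at h1
    rw [hθ.map_one, spec_self_eq n (-f n)] at h2
    obtain ⟨u, hu⟩ := exists_eq_spec_of_coherentU hne h1 h2
    exact ⟨u, by rw [hu, spec_neg]⟩
  choose! g hg using hlow
  choose! h hh using hupp
  have hg1 : ∀ n, g n 1 = 1 := fun n =>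
    ((spec_eq_spec_same ((hf n).symm.trans (hg n 1 hk))).1).symm
  have hgm : ∀ n, g n (-1) = -1 := fun n => by
    have := hg n (-1) hk'
    rw [hθ.map_neg_one, spec_self_eq n (f n)] at this
    exact (spec_eq_spec_same this).1.symm
  have hgi : ∀ n, g n Circle.negI = Circle.negI := fun n => by
    have := hθ.coherent n n _ hki _ hk' _ hki _ hki
      ((coherentU_spec_self _ _ _ _ _).2 (Or.inl rfl))
    rw [hg n _ hki, hθ.map_negI, spec_self_eq n (f n), coherentU_spec_self] at this
    exact this.resolve_right Circle.negI_ne_neg_one.symm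
  have hhi : ∀ n, h n Circle.negI = Circle.negI := fun n => by
    have := hθ.coherent n n _ hk _ hki _ hki _ hki
      ((coherentU_spec_self _ _ _ _ _).2 (Or.inr rfl))
    rw [hh n _ hki, hθ.map_negI, spec_self_eq n (f n), coherentU_spec_self] at this
    exact this.resolve_left Circle.negI_ne_one.symm
  have hfneg : ∀ n, f (-n) = -f n := fun n => by
    have := hθ.coherent n (-n) _ hk _ hki _ hki _ hk'
      (by rw [spec_neg, coherentU_spec_self]; exact Or.inr rfl)
    rw [hh n _ hki, hhi, hg (-n) _ hki, hgi, coherentU_spec] at this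
    have h0 : overlap (f n) (f (-n)) = 0 := by
      have e : ((overlap (f n) (f (-n)) : ℝ) : ℂ) * 2 = 0 := by
        simp only [Circle.coe_negI, Circle.coe_one, Circle.coe_neg] at this
        linear_combination this + ((overlap (f n) (f (-n)) : ℝ) : ℂ) * Complex.I_sq
      simpa using e
    rw [eq_neg_of_overlap_eq_zero h0, neg_neg]
  have hgh : ∀ n, ∀ z ∈ lowerArc, h n z = g (-n) z := fun n z hz => by
    have := hθ.coherent n (-n) _ hk _ hz _ hz _ hk'
      (by rw [spec_neg, coherentU_spec_self]; exact Or.inr rfl)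
    rw [hh n _ hz, hg (-n) _ hz, hfneg, spec_neg, coherentU_spec_self] at this
    exact this.resolve_left hne.symm
  refine ⟨f, g, hfneg, fun n => ⟨hg1 n, hgm n, hgi n⟩, fun n z hz w hw => ?_⟩
  have hcol : ∀ n, ∀ z ∈ lowerArc, ∀ w ∈ lowerArc, ∃ u,
      θ (spec n z w) = spec (f n) u (g (-n) w) := by
    intro n z hz w hw
    have h1 := hθ.coherent n n z hz w hw _ hk _ hw
      ((coherentU_spec_self _ _ _ _ _).2 (Or.inr rfl))
    have h2 := hθ.coherent n (-n) z hz w hw _ hw _ hk'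
      (by rw [spec_neg, coherentU_spec_self]; exact Or.inr rfl)
    rw [hh n _ hw, hgh n w hw] at h1
    rw [hg (-n) _ hw, hfneg, spec_neg] at h2
    exact exists_eq_spec_of_coherentU hne.symm h1 h2
  obtain ⟨u, hu⟩ := hcol n z hz w hw
  obtain ⟨v, hv⟩ := hcol (-n) w hw z hz
  rw [spec_neg, hfneg, spec_neg, neg_neg] at hv
  exact eq_spec_of_mem_lines hv hu

/-- The unit complex number `(3 - 4 * i) / 5`, the Cayley transform of `2`. -/
def _root_.Circle.cayleyTwo : Circle := Circle.mk ((3 - 4 * Complex.I) / 5) (by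
  rw [Complex.norm_def, Real.sqrt_eq_one]
  simp [Complex.normSq_apply]
  norm_num)

lemma _root_.Circle.coe_cayleyTwo : (Circle.cayleyTwo : ℂ) = (3 - 4 * Complex.I) / 5 := rfl

lemma _root_.cayleyTwo_mem_lowerArc : Circle.cayleyTwo ∈ lowerArc := by
  simp [lowerArc, Circle.coe_cayleyTwo]
  norm_num

lemma exists_common_map (hθ : IsNormalized θ) :
    ∃ (f : S2 → S2) (g : Circle → Circle), (∀ n, f (-n) = -f n) ∧
      (g 1 = 1 ∧ g (-1) = -1 ∧ g Circle.negI = Circle.negI) ∧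
      ∀ n, ∀ z ∈ lowerArc, ∀ w ∈ lowerArc, θ (spec n z w) = spec (f n) (g z) (g w) := by
  have hk := one_mem_lowerArc
  have hk' := neg_one_mem_lowerArc
  have hki := negI_mem_lowerArc
  have hk2 := cayleyTwo_mem_lowerArc
  obtain ⟨f, g, hf, hg, hθg⟩ := hθ.exists_spectral_maps
  have hscalar : ∀ n m, ∀ z ∈ lowerArc,
      spec (f n) (g n z) (g (-n) z) = spec (f m) (g m z) (g (-m) z) := by
    intro n m z hz
    rw [← hθg n z hz z hz, ← hθg m z hz z hz, spec_self_eq n m]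
  have hsymm : ∀ n, ∀ z ∈ lowerArc, g n z = g (-n) z := by
    intro n z hz
    by_contra hne
    have hdeg : ∀ m, ∃ k, f k = f n ∧ (k = m ∨ k = -m) := by
      intro m
      rcases spec_eq_spec (hscalar n m z hz) with ⟨-, -, h | h⟩ | ⟨-, -, h | h⟩
      · exact ⟨m, h.symm, Or.inl rfl⟩
      · exact absurd h hne
      · exact ⟨-m, by rw [hf, h], Or.inr rfl⟩
      · exact absurd h hne
    have hsame : ∀ k, f k = f n → ∀ z ∈ lowerArc, g k z = g n z ∧ g (-k) z = g (-n) z := by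
      intro k hk z hz
      have := hscalar k n z hz
      rw [hk] at this
      exact spec_eq_spec_same this
    obtain ⟨k₁, hk₁, e₁⟩ := hdeg (S2.mk 1 0 0 (by norm_num))
    obtain ⟨k₂, hk₂, e₂⟩ := hdeg (S2.mk 0 1 0 (by norm_num))
    have hov : overlap k₁ k₂ = 1 / 2 := by
      rcases e₁ with rfl | rfl <;> rcases e₂ with rfl | rfl <;> simp [overlap, S2.mk]
    have hpres : ∀ z ∈ lowerArc, ∀ w ∈ lowerArc, ∀ u ∈ lowerArc, ∀ v ∈ lowerArc,
        ((z : ℂ) - u) * ((w : ℂ) - v) + ((z : ℂ) - v) * ((w : ℂ) - u) = 0 →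
        g n z = g n u ∨ g (-n) w = g (-n) v := by
      intro z hz w hw u hu v hv h
      have := hθ.coherent k₁ k₂ z hz w hw u hu v hv (by
        rw [coherentU_spec, hov]
        push_cast
        linear_combination h / 2)
      rw [hθg _ _ hz _ hw, hθg _ _ hu _ hv, hk₁, hk₂, coherentU_spec_self,
        (hsame k₁ hk₁ z hz).1, (hsame k₁ hk₁ w hw).2, (hsame k₂ hk₂ u hu).1,
        (hsame k₂ hk₂ v hv).2] at this
      exact this
    have hA := hpres (-1) hk' _ hk2 1 hk _ hki (by
      simp only [Circle.coe_negI, Circle.coe_one, Circle.coe_neg, Circle.coe_cayleyTwo]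
      linear_combination (-4 / 5) * Complex.I_sq)
    have hB := hpres (-1) hk' _ hk2 _ hki 1 hk (by
      simp only [Circle.coe_negI, Circle.coe_one, Circle.coe_neg, Circle.coe_cayleyTwo]
      linear_combination (-4 / 5) * Complex.I_sq)
    rw [(hg n).1, (hg n).2.1, (hg (-n)).2.2] at hA
    rw [(hg n).2.2, (hg n).2.1, (hg (-n)).1] at hB
    have hA' := hA.resolve_left Circle.neg_one_ne_one
    have hB' := hB.resolve_left Circle.negI_ne_neg_one.symm
    exact Circle.negI_ne_one (hA'.symm.trans hB')
  have hconst : ∀ n m, ∀ z ∈ lowerArc, g n z = g m z := by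
    intro n m z hz
    have := hscalar n m z hz
    rw [← hsymm n z hz, ← hsymm m z hz, spec_self_eq _ (f m)] at this
    exact (spec_eq_spec_same this).1
  let e : S2 := S2.mk 1 0 0 (by norm_num)
  refine ⟨f, g e, hf, hg e, fun n z hz w hw => ?_⟩
  rw [hθg n z hz w hw, hconst n e z hz, hconst (-n) e w hw]

end IsNormalized

/-! ### The scalar function and the induced isometry of the sphere -/

/-- The Cayley transform of a real number. -/
def cay (t : ℝ) : Circle := Circle.mk ((t - Complex.I) / (t + Complex.I)) (by
  rw [norm_div, div_eq_one_iff_eq]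
  · have := Complex.norm_conj ((t : ℂ) + Complex.I)
    rw [← this]
    simp [sub_eq_add_neg]
  · rw [norm_ne_zero_iff]
    intro h
    simpa using congrArg Complex.im h)

lemma coe_cay (t : ℝ) : (cay t : ℂ) = (t - Complex.I) / (t + Complex.I) := rfl

lemma add_I_ne_zero (t : ℝ) : (t : ℂ) + Complex.I ≠ 0 := fun h => by
  simpa using congrArg Complex.im h

lemma cay_mem_lowerArc {t : ℝ} (ht : 0 ≤ t) : cay t ∈ lowerArc := by
  have : (cay t : ℂ).im = -(2 * t) / (t ^ 2 + 1) := by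
    rw [coe_cay, Complex.div_im]
    simp [Complex.normSq_apply]
    field_simp
    ring
  change (cay t : ℂ).im ≤ 0
  rw [this]
  exact div_nonpos_of_nonpos_of_nonneg (by linarith) (by positivity)

lemma cay_one : cay 1 = Circle.negI := Circle.ext (by
  rw [coe_cay, Circle.coe_negI, div_eq_iff (add_I_ne_zero 1)]
  simp
  linear_combination Complex.I_sq)

lemma cay_injective : Function.Injective cay := fun s t h => by
  have h' := congrArg (fun z : Circle => (z : ℂ)) h
  simp only [coe_cay] at h'
  rw [div_eq_div_iff (add_I_ne_zero s) (add_I_ne_zero t)] at h'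
  have : (2 * Complex.I) * (s : ℂ) = (2 * Complex.I) * t := by linear_combination h'
  have := mul_left_cancel₀ (by simp) this
  exact_mod_cast this

/-- Coherency of the points with spectra `{c(0), c(a)}` and `{c(∞), c(b)}`. -/
lemma cay_relation (q a b : ℝ) :
    (q : ℂ) * (((-1 : Circle) - (1 : Circle) : ℂ) * ((cay a : ℂ) - cay b))
      + (1 - q) * (((-1 : Circle) - cay b : ℂ) * ((cay a : ℂ) - (1 : Circle))) = 0 ↔ b = q * a := by
  have ha := add_I_ne_zero a
  have hb := add_I_ne_zero b
  have e : (q : ℂ) * (((-1 : Circle) - (1 : Circle) : ℂ) * ((cay a : ℂ) - cay b))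
      + (1 - q) * (((-1 : Circle) - cay b : ℂ) * ((cay a : ℂ) - (1 : Circle)))
      = 4 * Complex.I * ((b - q * a : ℝ) : ℂ) / ((a + Complex.I) * (b + Complex.I)) := by
    simp only [coe_cay, Circle.coe_neg, Circle.coe_one]
    field_simp
    push_cast
    ring
  rw [e, div_eq_zero_iff]
  simp only [mul_eq_zero, ha, hb, Complex.I_ne_zero, Complex.ofReal_eq_zero, sub_eq_zero]
  norm_num

lemma exists_overlap_eq {p : ℝ} (h0 : 0 ≤ p) (h1 : p ≤ 1) : ∃ n m, overlap n m = p := by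
  refine ⟨S2.mk 0 0 1 (by norm_num), S2.mk (2 * √(p * (1 - p))) 0 (2 * p - 1) ?_, ?_⟩
  · rw [mul_pow, Real.sq_sqrt (mul_nonneg h0 (by linarith))]
    ring
  · simp [overlap, S2.mk]

/-- A bounded function on `[0, 1]` commuting with halving and with reflection is the identity. -/
lemma eq_self_of_half_of_reflect {G : ℝ → ℝ} (hb : ∀ x, 0 ≤ x → x ≤ 1 → |G x - x| ≤ 1)
    (hhalf : ∀ x, 0 ≤ x → x ≤ 1 → G (1 / 2 * x) = 1 / 2 * G x)
    (hrefl : ∀ x, 0 ≤ x → x ≤ 1 → G (1 - x) = 1 - G x) :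
    ∀ x, 0 ≤ x → x ≤ 1 → G x = x := by
  have key : ∀ k : ℕ, ∀ x, 0 ≤ x → x ≤ 1 → |G x - x| ≤ (1 / 2) ^ k := by
    intro k
    induction k with
    | zero => simpa using hb
    | succ k ih =>
      have hsmall : ∀ x, 0 ≤ x → x ≤ 1 / 2 → |G x - x| ≤ (1 / 2) ^ (k + 1) := by
        intro x hx0 hx1
        have h := ih (2 * x) (by linarith) (by linarith)
        have e := hhalf (2 * x) (by linarith) (by linarith)
        rw [show 1 / 2 * (2 * x) = x by ring] at e
        rw [e, show 1 / 2 * G (2 * x) - x = 1 / 2 * (G (2 * x) - 2 * x) by ring, abs_mul,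
          abs_of_pos (by norm_num : (0 : ℝ) < 1 / 2), pow_succ']
        linarith
      intro x hx0 hx1
      rcases le_total x (1 / 2) with hx | hx
      · exact hsmall x hx0 hx
      · have h := hsmall (1 - x) (by linarith) (by linarith)
        rwa [hrefl x hx0 hx1, show 1 - G x - (1 - x) = -(G x - x) by ring, abs_neg] at h
  intro x hx0 hx1
  have hlim := tendsto_pow_atTop_nhds_zero_of_lt_one (r := (1 / 2 : ℝ)) (by norm_num) (by norm_num)
  have : |G x - x| ≤ 0 := ge_of_tendsto' hlim fun k => key k x hx0 hx1
  linarith [abs_nonpos_iff.1 this]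

lemma IsNormalized.exists_isometry {θ : U2 → U2} (hθ : IsNormalized θ) :
    ∃ f : S2 → S2, (∀ n, f (-n) = -f n) ∧ (∀ n m, overlap (f n) (f m) = overlap n m) ∧
      ∀ n s t, 0 ≤ s → s ≤ 1 → 0 ≤ t → t ≤ 1 →
        θ (spec n (cay s) (cay t)) = spec (f n) (cay s) (cay t) := by
  obtain ⟨f, g, hf, ⟨hg1, hgm, hgi⟩, hθg⟩ := hθ.exists_common_map
  have hk := one_mem_lowerArc
  have hk' := neg_one_mem_lowerArc
  have hrel : ∀ n m t, 0 ≤ t →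
      CoherentU (spec (f n) (-1) (g (cay t))) (spec (f m) 1 (g (cay (overlap n m * t)))) := by
    intro n m t ht
    have ht1 := cay_mem_lowerArc ht
    have ht2 := cay_mem_lowerArc (mul_nonneg (overlap_nonneg n m) ht)
    have := hθ.coherent n m (-1) hk' (cay t) ht1 1 hk (cay (overlap n m * t)) ht2 (by
      rw [coherentU_spec, cay_relation])
    rwa [hθg _ _ hk' _ ht1, hθg _ _ hk _ ht2, hg1, hgm] at this
  have hgc : ∀ n m, g (cay (overlap n m)) = cay (overlap (f n) (f m)) := by
    intro n m
    have h1 := hrel n m 1 zero_le_one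
    rw [mul_one, cay_one, hgi, coherentU_spec] at h1
    have h2 := (cay_relation (overlap (f n) (f m)) 1 (overlap (f n) (f m))).2 (by ring)
    rw [cay_one] at h2
    generalize overlap (f n) (f m) = q at *
    have hc : (1 + q : ℂ) + (1 - q) * Complex.I ≠ 0 := fun h => by
      have hre := congrArg Complex.re h
      have him := congrArg Complex.im h
      simp at hre him
      linarith
    simp only [Circle.coe_neg, Circle.coe_one, Circle.coe_negI] at h1 h2
    apply Circle.ext
    apply mul_left_cancel₀ hc
    linear_combination h1 - h2
  have hex : ∀ p : ℝ, ∃ q : ℝ, 0 ≤ p → p ≤ 1 → g (cay p) = cay q := by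
    intro p
    by_cases hp : 0 ≤ p ∧ p ≤ 1
    · obtain ⟨n, m, rfl⟩ := exists_overlap_eq hp.1 hp.2
      exact ⟨_, fun _ _ => hgc n m⟩
    · exact ⟨0, fun h0 h1 => absurd ⟨h0, h1⟩ hp⟩
  choose G hG using hex
  have hGov : ∀ n m, overlap (f n) (f m) = G (overlap n m) := fun n m =>
    cay_injective ((hgc n m).symm.trans (hG _ (overlap_nonneg n m) (overlap_le_one n m)))
  have hrefl : ∀ x, 0 ≤ x → x ≤ 1 → G (1 - x) = 1 - G x := by
    intro x h0 h1
    obtain ⟨n, m, rfl⟩ := exists_overlap_eq h0 h1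
    rw [← overlap_neg_right, ← hGov, hf, overlap_neg_right, hGov]
  have hGhalf : G (1 / 2) = 1 / 2 := by
    have := hrefl (1 / 2) (by norm_num) (by norm_num)
    norm_num at this ⊢
    linarith
  have hhalf : ∀ x, 0 ≤ x → x ≤ 1 → G (1 / 2 * x) = 1 / 2 * G x := by
    intro x h0 h1
    obtain ⟨n, m, hnm⟩ := exists_overlap_eq (p := 1 / 2) (by norm_num) (by norm_num)
    have := hrel n m x h0
    rwa [hnm, hG x h0 h1, hG (1 / 2 * x) (by linarith) (by linarith), coherentU_spec,
      cay_relation, hGov, hnm, hGhalf] at this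
  have hbd : ∀ x, 0 ≤ x → x ≤ 1 → |G x - x| ≤ 1 := by
    intro x h0 h1
    obtain ⟨n, m, rfl⟩ := exists_overlap_eq h0 h1
    rw [← hGov, abs_le]
    constructor <;> linarith [overlap_nonneg (f n) (f m), overlap_le_one (f n) (f m)]
  have hGid := eq_self_of_half_of_reflect hbd hhalf hrefl
  refine ⟨f, hf, fun n m => ?_, fun n s t hs0 hs1 ht0 ht1 => ?_⟩
  · rw [hGov, hGid _ (overlap_nonneg n m) (overlap_le_one n m)]
  · rw [hθg _ _ (cay_mem_lowerArc hs0) _ (cay_mem_lowerArc ht0), hG s hs0 hs1, hG t ht0 ht1,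
      hGid s hs0 hs1, hGid t ht0 ht1]

lemma surjective_of_overlap_eq {f : S2 → S2} (h : ∀ n m, overlap (f n) (f m) = overlap n m) :
    Function.Surjective f := by
  have hdot : ∀ n m : S2, (f n).1 0 * (f m).1 0 + (f n).1 1 * (f m).1 1 + (f n).1 2 * (f m).1 2
      = n.1 0 * m.1 0 + n.1 1 * m.1 1 + n.1 2 * m.1 2 := by
    intro n m
    have := h n m
    unfold overlap at this
    linarith
  let e : Fin 3 → S2 := ![S2.mk 1 0 0 (by norm_num), S2.mk 0 1 0 (by norm_num),
    S2.mk 0 0 1 (by norm_num)]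
  let R : Matrix (Fin 3) (Fin 3) ℝ := fun i j => (f (e i)).1 j
  have hR : R * Rᵀ = 1 := by
    ext i j
    have : (R * Rᵀ) i j = (e i).1 0 * (e j).1 0 + (e i).1 1 * (e j).1 1
        + (e i).1 2 * (e j).1 2 := by
      rw [← hdot]
      rw [Matrix.mul_apply, Fin.sum_univ_three]
      rfl
    rw [this]
    fin_cases i <;> fin_cases j <;> simp [e, S2.mk]
  have hR' : Rᵀ * R = 1 := mul_eq_one_comm.1 hR
  have hmul : ∀ n : S2, R *ᵥ (f n).1.ofLp = n.1.ofLp := by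
    intro n
    ext i
    have : (R *ᵥ (f n).1.ofLp) i = (e i).1 0 * n.1 0 + (e i).1 1 * n.1 1
        + (e i).1 2 * n.1 2 := by
      rw [← hdot]
      simp [R, Matrix.mulVec, dotProduct, Fin.sum_univ_three]
    rw [this]
    fin_cases i <;> simp [e, S2.mk]
  intro m
  have hm := m.sum_sq
  have hnorm : (R *ᵥ m.1.ofLp) ⬝ᵥ (R *ᵥ m.1.ofLp) = 1 := by
    rw [Matrix.dotProduct_mulVec, Matrix.vecMul_mulVec, ← Matrix.dotProduct_mulVec, hR',
      Matrix.one_mulVec]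
    simp [dotProduct, Fin.sum_univ_three]
    linarith
  let n : S2 := S2.mk ((R *ᵥ m.1.ofLp) 0) ((R *ᵥ m.1.ofLp) 1) ((R *ᵥ m.1.ofLp) 2) (by
    rw [dotProduct, Fin.sum_univ_three] at hnorm
    linarith)
  have hn : n.1.ofLp = R *ᵥ m.1.ofLp := by
    ext i
    fin_cases i <;> rfl
  refine ⟨n, Subtype.ext ((WithLp.ofLp_injective 2) ?_)⟩
  have := congrArg (fun x => Rᵀ *ᵥ x) ((hmul n).trans hn)
  simpa [Matrix.mulVec_mulVec, hR'] using this

lemma exists_isAut_of_isometry {f : S2 → S2} (hf : ∀ n, f (-n) = -f n)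
    (h : ∀ n m, overlap (f n) (f m) = overlap n m) :
    ∃ Φ : U2 → U2, IsAut Φ ∧ ∀ n z w, Φ (spec n z w) = spec (f n) z w := by
  choose nn zz ww hs using exists_spec
  have hval : ∀ n z w, spec (f (nn (spec n z w))) (zz (spec n z w)) (ww (spec n z w)) =
      spec (f n) z w := by
    intro n z w
    rcases spec_eq_spec (hs (spec n z w)) with ⟨h1, h2, h3 | h3⟩ | ⟨h1, h2, h3 | h3⟩
    · rw [← h1, ← h2, ← h3]
    · rw [← h1, ← h2, h3]
      exact spec_self_eq _ _ _
    · have h4 : f n = -f (nn (spec n z w)) := (congrArg f h3).trans (hf _)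
      rw [← h1, ← h2, h4, spec_neg]
    · rw [← h1, ← h2, h3]
      exact spec_self_eq _ _ _
  have hcoh : ∀ n m z w u v, CoherentU (spec n z w) (spec m u v) ↔
      CoherentU (spec (f n) z w) (spec (f m) u v) := by
    intro n m z w u v
    rw [coherentU_spec, coherentU_spec, h]
  refine ⟨fun U => spec (f (nn U)) (zz U) (ww U), ⟨⟨?_, ?_⟩, ?_⟩, hval⟩
  · intro U V hUV
    obtain ⟨n, z, w, rfl⟩ := exists_spec U
    obtain ⟨m, u, v, rfl⟩ := exists_spec V
    simp only [hval] at hUV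
    have hinj : ∀ {a b : S2}, f a = f b → a = b := fun {a b} hab =>
      eq_of_overlap_eq_one (by rw [← h, hab, overlap_self])
    rcases spec_eq_spec hUV with ⟨rfl, rfl, h3 | rfl⟩ | ⟨rfl, rfl, h3 | rfl⟩
    · rw [hinj h3]
    · exact spec_self_eq _ _ _
    · rw [← hf] at h3
      rw [hinj h3, spec_neg]
    · exact spec_self_eq _ _ _
  · intro V
    obtain ⟨m, u, v, rfl⟩ := exists_spec V
    obtain ⟨n, rfl⟩ := surjective_of_overlap_eq h m
    exact ⟨spec n u v, hval n u v⟩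
  · intro U V
    obtain ⟨n, z, w, rfl⟩ := exists_spec U
    obtain ⟨m, u, v, rfl⟩ := exists_spec V
    simp only [hval]
    exact hcoh _ _ _ _ _ _

/-! ### Fractional linear transformations of the unitary group -/

/-- The block matrix with entries `α, β, γ, δ` preserves the hermitian form of signature
`(2, 2)`. -/
structure IsPseudoUnitary (α β γ δ : Mat2) : Prop where
  left : αᴴ * α - γᴴ * γ = 1
  mixed : αᴴ * β = γᴴ * δ
  right : δᴴ * δ - βᴴ * β = 1

namespace IsPseudoUnitary

variable {α β γ δ : Mat2}

lemma mixed' (h : IsPseudoUnitary α β γ δ) : βᴴ * α = δᴴ * γ := by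
  simpa using congrArg Matrix.conjTranspose h.mixed

lemma inverse (h : IsPseudoUnitary α β γ δ) : IsPseudoUnitary αᴴ (-γᴴ) (-βᴴ) δᴴ := by
  have h1 : fromBlocks αᴴ (-γᴴ) (-βᴴ) δᴴ * fromBlocks α β γ δ = 1 := by
    rw [fromBlocks_multiply, ← fromBlocks_one]
    congr 1
    · simpa [← sub_eq_add_neg] using h.left
    · simp [h.mixed]
    · simp [h.mixed']
    · rw [← h.right]
      noncomm_ring
  rw [mul_eq_one_comm, fromBlocks_multiply, ← fromBlocks_one, fromBlocks_inj] at h1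
  obtain ⟨h11, h12, -, h22⟩ := h1
  refine ⟨?_, ?_, ?_⟩
  · simpa [← sub_eq_add_neg] using h11
  · simp only [conjTranspose_conjTranspose, conjTranspose_neg, neg_mul, mul_neg] at h12 ⊢
    rw [neg_add_eq_zero] at h12
    rw [h12]
  · simp only [conjTranspose_conjTranspose, conjTranspose_neg, neg_mul, mul_neg, neg_neg] at h22 ⊢
    rw [← h22]
    abel

lemma star_mul_sub (h : IsPseudoUnitary α β γ δ) (U V : Mat2) :
    (α * V + β)ᴴ * (α * U + β) - (γ * V + δ)ᴴ * (γ * U + δ) = Vᴴ * U - 1 := by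
  have : (α * V + β)ᴴ * (α * U + β) - (γ * V + δ)ᴴ * (γ * U + δ)
      = Vᴴ * (αᴴ * α - γᴴ * γ) * U + Vᴴ * (αᴴ * β - γᴴ * δ) + (βᴴ * α - δᴴ * γ) * U
        - (δᴴ * δ - βᴴ * β) := by
    simp only [conjTranspose_add, conjTranspose_mul]
    noncomm_ring
  rw [this, h.left, h.right, h.mixed, h.mixed']
  simp

lemma isUnit_bot (h : IsPseudoUnitary α β γ δ) (U : U2) :
    IsUnit (γ * (U : Mat2) + δ).det := by
  have hU : (U : Mat2)ᴴ * U = 1 := Matrix.UnitaryGroup.star_mul_self U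
  rw [isUnit_iff_ne_zero]
  intro hdet
  obtain ⟨x, hx, hbx⟩ := Matrix.exists_mulVec_eq_zero_iff.2 hdet
  have htt := h.star_mul_sub U U
  rw [hU, sub_self, sub_eq_zero] at htt
  have htx : (α * (U : Mat2) + β) *ᵥ x = 0 := by
    rw [← Matrix.conjTranspose_mul_self_mulVec_eq_zero, htt, ← Matrix.mulVec_mulVec, hbx,
      Matrix.mulVec_zero]
  have hone : δᴴ * (γ * (U : Mat2) + δ) - βᴴ * (α * (U : Mat2) + β) = 1 := by
    have : δᴴ * (γ * (U : Mat2) + δ) - βᴴ * (α * (U : Mat2) + β)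
        = (δᴴ * γ - βᴴ * α) * U + (δᴴ * δ - βᴴ * β) := by noncomm_ring
    rw [this, h.right, h.mixed', sub_self, zero_mul, zero_add]
  apply hx
  rw [← Matrix.one_mulVec x, ← hone, Matrix.sub_mulVec, ← Matrix.mulVec_mulVec,
    ← Matrix.mulVec_mulVec, hbx, htx]
  simp

lemma star_mul_sub_one (h : IsPseudoUnitary α β γ δ) (U V : U2) :
    ((α * (V : Mat2) + β) * (γ * (V : Mat2) + δ)⁻¹)ᴴ * ((α * U + β) * (γ * (U : Mat2) + δ)⁻¹) - 1
      = ((γ * (V : Mat2) + δ)⁻¹)ᴴ * ((V : Mat2)ᴴ * U - 1) * (γ * (U : Mat2) + δ)⁻¹ := by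
  have hbU := Matrix.mul_nonsing_inv _ (h.isUnit_bot U)
  have hbV := Matrix.mul_nonsing_inv _ (h.isUnit_bot V)
  rw [← h.star_mul_sub U V]
  generalize α * (U : Mat2) + β = tU at *
  generalize α * (V : Mat2) + β = tV at *
  generalize γ * (U : Mat2) + δ = bU at *
  generalize γ * (V : Mat2) + δ = bV at *
  have hbV' : (bV⁻¹)ᴴ * bVᴴ = 1 := by rw [← conjTranspose_mul, hbV, conjTranspose_one]
  calc _ = (bV⁻¹)ᴴ * (tVᴴ * tU) * bU⁻¹ - ((bV⁻¹)ᴴ * bVᴴ) * (bU * bU⁻¹) := by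
        rw [hbU, hbV', conjTranspose_mul]
        noncomm_ring
    _ = _ := by noncomm_ring

/-- The fractional linear transformation `U ↦ (αU + β)(γU + δ)⁻¹`. -/
def map (h : IsPseudoUnitary α β γ δ) (U : U2) : U2 :=
  ⟨(α * (U : Mat2) + β) * (γ * (U : Mat2) + δ)⁻¹, by
    rw [Matrix.mem_unitaryGroup_iff', ← sub_eq_zero]
    have hU : (U : Mat2)ᴴ * U = 1 := Matrix.UnitaryGroup.star_mul_self U
    have := h.star_mul_sub_one U U
    rwa [hU, sub_self, mul_zero, zero_mul] at this⟩

lemma map_mul (h : IsPseudoUnitary α β γ δ) (U : U2) :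
    (h.map U : Mat2) * (γ * (U : Mat2) + δ) = α * (U : Mat2) + β := by
  simp only [map]
  rw [Matrix.mul_assoc, Matrix.nonsing_inv_mul _ (h.isUnit_bot U), Matrix.mul_one]

lemma map_inverse (h : IsPseudoUnitary α β γ δ) (U : U2) : h.map (h.inverse.map U) = U := by
  have h1 := h.inverse.map_mul U
  have h2 := h.map_mul (h.inverse.map U)
  have h4 := congrArg (· * (-βᴴ * (U : Mat2) + δᴴ)) h2
  have h5 := h.inverse
  have e1 : γ * (αᴴ * (U : Mat2) + -γᴴ) + δ * (-βᴴ * (U : Mat2) + δᴴ) = 1 := by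
    have a := h5.right
    have b := h5.mixed'
    simp only [conjTranspose_conjTranspose, conjTranspose_neg, neg_mul, mul_neg, neg_neg,
      neg_inj] at a b
    rw [← a, Matrix.mul_add, Matrix.mul_add, ← Matrix.mul_assoc, b]
    noncomm_ring
  have e2 : α * (αᴴ * (U : Mat2) + -γᴴ) + β * (-βᴴ * (U : Mat2) + δᴴ) = U := by
    have a := h5.left
    have b := h5.mixed
    simp only [conjTranspose_conjTranspose, conjTranspose_neg, neg_mul, mul_neg, neg_neg,
      neg_inj] at a b
    have : (U : Mat2) = (α * αᴴ - β * βᴴ) * U := by rw [a, one_mul]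
    nth_rw 3 [this]
    rw [Matrix.mul_add, Matrix.mul_add, mul_neg, b]
    noncomm_ring
  simp only [Matrix.mul_assoc, Matrix.add_mul, h1] at h4
  rw [e1, e2, Matrix.mul_one] at h4
  exact Subtype.ext h4

lemma inverse_map (h : IsPseudoUnitary α β γ δ) (U : U2) : h.inverse.map (h.map U) = U := by
  have := h.inverse.map_inverse U
  simpa only [conjTranspose_conjTranspose, conjTranspose_neg, neg_neg] using this

lemma continuous_map (h : IsPseudoUnitary α β γ δ) : Continuous h.map := by
  refine Continuous.subtype_mk ?_ _
  have hc : Continuous fun U : U2 => γ * (U : Mat2) + δ := by fun_prop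
  have hinv : Continuous fun U : U2 => (γ * (U : Mat2) + δ)⁻¹ := by
    simp only [Matrix.inv_def, Ring.inverse_eq_inv']
    exact (hc.matrix_det.inv₀ fun U => (h.isUnit_bot U).ne_zero).smul hc.matrix_adjugate
  fun_prop

/-- The fractional linear transformation as a homeomorphism. -/
def homeomorph (h : IsPseudoUnitary α β γ δ) : U2 ≃ₜ U2 where
  toFun := h.map
  invFun := h.inverse.map
  left_inv := h.inverse_map
  right_inv := h.map_inverse
  continuous_toFun := h.continuous_map
  continuous_invFun := h.inverse.continuous_map

lemma isAut_map (h : IsPseudoUnitary α β γ δ) : IsAut h.map := by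
  refine ⟨h.homeomorph.bijective, fun U V => ?_⟩
  have key : ∀ U V : U2, CoherentU U V ↔ ((V : Mat2)ᴴ * U - 1).det = 0 := by
    intro U V
    rw [← coherentU_mul_left_iff V⁻¹, coherentU_iff, inv_mul_cancel]
    rfl
  rw [key, key]
  have e := h.star_mul_sub_one U V
  have hU := (h.isUnit_bot U).ne_zero
  have hV := (h.isUnit_bot V).ne_zero
  change _ ↔ (((α * (V : Mat2) + β) * (γ * (V : Mat2) + δ)⁻¹)ᴴ
    * ((α * U + β) * (γ * (U : Mat2) + δ)⁻¹) - 1).det = 0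
  rw [e, det_mul, det_mul, det_conjTranspose]
  simp [hU, hV]

end IsPseudoUnitary

lemma IsAut.comp {Φ Ψ : U2 → U2} (hΦ : IsAut Φ) (hΨ : IsAut Ψ) : IsAut (Φ ∘ Ψ) :=
  ⟨hΦ.1.comp hΨ.1, fun U V => (hΨ.2 U V).trans (hΦ.2 _ _)⟩

lemma IsAut.of_leftInverse {Φ Ψ : U2 → U2} (hΦ : IsAut Φ) (h : Function.LeftInverse Ψ Φ) :
    IsAut Ψ := by
  have hr : Function.RightInverse Ψ Φ := h.rightInverse_of_surjective hΦ.1.2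
  refine ⟨⟨hr.injective, h.surjective⟩, fun U V => ?_⟩
  rw [hΦ.2 (Ψ U), hr, hr]

lemma isAut_inv : IsAut fun U : U2 => U⁻¹ := by
  refine ⟨inv_involutive.bijective, fun U V => ?_⟩
  rw [coherentU_iff, coherentU_iff]
  have : ((U⁻¹ : U2) : Mat2) - ((V⁻¹ : U2) : Mat2) = ((U : Mat2) - (V : Mat2))ᴴ := by
    rw [conjTranspose_sub]
    rfl
  rw [this, det_conjTranspose, star_eq_zero]

/-! ### The parametrization of a matrix interval -/

lemma eq_cayley {U : U2} {X N D : Mat2} (hD : IsUnit D.det) (hX : X * D = N)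
    (h : (U : Mat2) * (N + Complex.I • D) = N - Complex.I • D) : U = cayley X := by
  have h1 : (U : Mat2) * (X + Complex.I • (1 : Mat2)) = X - Complex.I • (1 : Mat2) := by
    have hD' := Matrix.mul_nonsing_inv _ hD
    have := congrArg (· * D⁻¹) h
    simp only [← hX, Matrix.mul_assoc, Matrix.add_mul, Matrix.sub_mul, smul_mul_assoc, hD',
      mul_one] at this
    exact this
  have h2 : ((-Complex.I / 2) • (1 - (U : Mat2))) * (X + Complex.I • (1 : Mat2)) = 1 := by
    rw [smul_mul_assoc, sub_mul, h1, one_mul, add_sub_sub_cancel, ← two_smul ℂ, smul_smul,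
      smul_smul]
    convert one_smul ℂ (1 : Mat2) using 2
    linear_combination -Complex.I_sq
  have h3 : cayleyMat X = U := by
    rw [cayleyMat, ← h1, Matrix.mul_assoc, mul_nonsing_inv _ (isUnit_det_of_left_inverse h2),
      mul_one]
  have h4 : cayleyMat X ∈ Matrix.unitaryGroup (Fin 2) ℂ := h3 ▸ U.2
  rw [cayley, dif_pos h4]
  exact Subtype.ext h3.symm

lemma isPseudoUnitary_of_symplectic {N₁ N₀ D₁ D₀ : Mat2}
    (h1 : N₁ᴴ * D₁ - D₁ᴴ * N₁ = (2 * Complex.I) • (1 : Mat2))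
    (h2 : N₁ᴴ * D₀ = D₁ᴴ * N₀)
    (h3 : N₀ᴴ * D₀ - D₀ᴴ * N₀ = -(2 * Complex.I) • (1 : Mat2)) :
    IsPseudoUnitary ((1 / 2 : ℂ) • (N₁ - Complex.I • D₁)) ((1 / 2 : ℂ) • (N₀ - Complex.I • D₀))
      ((1 / 2 : ℂ) • (N₁ + Complex.I • D₁)) ((1 / 2 : ℂ) • (N₀ + Complex.I • D₀)) := by
  have key : ∀ M E N D : Mat2, ((1 / 2 : ℂ) • (M - Complex.I • E))ᴴ
      * ((1 / 2 : ℂ) • (N - Complex.I • D)) - ((1 / 2 : ℂ) • (M + Complex.I • E))ᴴ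
      * ((1 / 2 : ℂ) • (N + Complex.I • D)) = (-Complex.I / 2) • (Mᴴ * D - Eᴴ * N) := by
    intro M E N D
    simp only [conjTranspose_smul, conjTranspose_add, conjTranspose_sub,
      sub_mul, mul_sub, add_mul, mul_add, smul_mul_assoc, mul_smul_comm]
    simp only [Complex.star_def, Complex.conj_I, map_div₀, map_one, map_ofNat]
    module
  refine ⟨?_, ?_, ?_⟩
  · rw [key, h1, smul_smul]
    convert one_smul ℂ (1 : Mat2) using 2
    linear_combination -Complex.I_sq
  · rw [← sub_eq_zero, key, h2, sub_self, smul_zero]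
  · rw [← neg_sub, key, h3, smul_smul, ← neg_smul]
    convert one_smul ℂ (1 : Mat2) using 2
    linear_combination -Complex.I_sq

lemma exists_mul_eq_of_posSemidef {B K N D : Mat2} (hB : B.IsHermitian) (hKB : K * B = 1)
    (hK : K.PosDef)
    (hP : (Nᴴ * D - Nᴴ * K * N).PosSemidef) (hker : ∀ x, N *ᵥ x = 0 → D *ᵥ x = 0 → x = 0) :
    IsUnit D.det ∧ ∃ Y, Y * D = N ∧ Y.PosSemidef ∧ (B - Y).PosSemidef := by
  have hBK : B * K = 1 := mul_eq_one_comm.1 hKB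
  have hQ : (Nᴴ * K * N).PosSemidef := hK.posSemidef.conjTranspose_mul_mul_same N
  have hM : (Nᴴ * D).PosSemidef := by simpa using hP.add hQ
  have hD : IsUnit D.det := by
    rw [isUnit_iff_ne_zero]
    intro hdet
    obtain ⟨x, hx, hDx⟩ := Matrix.exists_mulVec_eq_zero_iff.2 hdet
    refine hx (hker x ?_ hDx)
    by_contra hNx
    have h1 := hP.dotProduct_mulVec_nonneg x
    have h2 := hK.dotProduct_mulVec_pos hNx
    have h3 : star x ⬝ᵥ (Nᴴ * K * N) *ᵥ x = star (N *ᵥ x) ⬝ᵥ K *ᵥ N *ᵥ x := by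
      rw [star_mulVec, ← dotProduct_mulVec, mulVec_mulVec, mulVec_mulVec]
    rw [sub_mulVec, dotProduct_sub, ← mulVec_mulVec x Nᴴ D, hDx, mulVec_zero, dotProduct_zero,
      zero_sub, h3] at h1
    exact absurd h2 (not_lt_of_ge (neg_nonneg.1 h1))
  have hDD := Matrix.mul_nonsing_inv _ hD
  have hDD' : (D⁻¹)ᴴ * Dᴴ = 1 := by rw [← conjTranspose_mul, hDD, conjTranspose_one]
  have hMherm : Dᴴ * N = Nᴴ * D := by simpa using hM.isHermitian.eq
  have hYeq : N * D⁻¹ = (D⁻¹)ᴴ * (Nᴴ * D) * D⁻¹ := by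
    rw [← hMherm, ← Matrix.mul_assoc, hDD', one_mul]
  have hY : (N * D⁻¹).PosSemidef := by
    rw [hYeq]
    exact hM.conjTranspose_mul_mul_same _
  refine ⟨hD, N * D⁻¹, by rw [Matrix.mul_assoc, nonsing_inv_mul _ hD, mul_one], hY, ?_⟩
  have h1 := hP.conjTranspose_mul_mul_same D⁻¹
  have h2 := hK.posSemidef.conjTranspose_mul_mul_same (B - N * D⁻¹)
  have hYH : (D⁻¹)ᴴ * Nᴴ = N * D⁻¹ := by rw [← conjTranspose_mul, hY.isHermitian.eq]
  have e1 : (D⁻¹)ᴴ * (Nᴴ * D - Nᴴ * K * N) * D⁻¹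
      = N * D⁻¹ - N * D⁻¹ * K * (N * D⁻¹) := by
    rw [mul_sub, sub_mul, ← hYeq]
    simp only [← Matrix.mul_assoc, hYH]
  have e2 : (B - N * D⁻¹)ᴴ * K * (B - N * D⁻¹)
      = B - N * D⁻¹ - N * D⁻¹ + N * D⁻¹ * K * (N * D⁻¹) := by
    rw [conjTranspose_sub, hB.eq, hY.isHermitian.eq, sub_mul, hBK, sub_mul,
      mul_sub (N * D⁻¹ * K), Matrix.mul_assoc _ K B, hKB]
    noncomm_ring
  rw [e1] at h1
  rw [e2] at h2
  have := h1.add h2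
  convert this using 1
  abel

lemma posSemidef_specMat (n : S2) {a b : ℝ} (ha : 0 ≤ a) (hb : 0 ≤ b) :
    (specMat n a b).PosSemidef := by
  have h := posSemidef_conjTranspose_mul_self (specMat n (√a : ℂ) (√b : ℂ))
  rwa [← star_eq_conjTranspose, star_specMat, specMat_mul, Complex.conj_ofReal,
    Complex.conj_ofReal, ← Complex.ofReal_mul, ← Complex.ofReal_mul, Real.mul_self_sqrt ha,
    Real.mul_self_sqrt hb] at h

lemma exists_invertible_mul_conjTranspose {M : Mat2} (hM : M.PosDef) :
    ∃ T : Mat2, IsUnit T.det ∧ T * Tᴴ = M := by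
  open scoped MatrixOrder in
  obtain ⟨S, hS⟩ := CStarAlgebra.nonneg_iff_eq_star_mul_self.mp hM.posSemidef.nonneg
  refine ⟨Sᴴ, ?_, by rw [conjTranspose_conjTranspose, hS, star_eq_conjTranspose]⟩
  have := (Matrix.isUnit_iff_isUnit_det _).1 hM.isUnit
  rw [hS, det_mul] at this
  exact isUnit_of_mul_isUnit_left this

lemma posDef_inv_sub_inv {B C : Mat2} (hC : C.PosDef) (hBC : (B - C).PosDef) :
    (C⁻¹ - B⁻¹).PosDef := by
  have hB : B.PosDef := by simpa using hBC.add hC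
  have hBB := nonsing_inv_mul _ ((Matrix.isUnit_iff_isUnit_det _).1 hB.isUnit)
  have hBB' := mul_nonsing_inv _ ((Matrix.isUnit_iff_isUnit_det _).1 hB.isUnit)
  have hCC := nonsing_inv_mul _ ((Matrix.isUnit_iff_isUnit_det _).1 hC.isUnit)
  have hCC' := mul_nonsing_inv _ ((Matrix.isUnit_iff_isUnit_det _).1 hC.isUnit)
  have h1 := hC.inv.posSemidef.conjTranspose_mul_mul_same ((B - C) * B⁻¹)
  have h2 := (Matrix.IsUnit.posDef_star_right_conjugate_iff hB.inv.isUnit).2 hBC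
  have h3 := h2.add_posSemidef h1
  convert h3 using 1
  rw [conjTranspose_mul, hBC.isHermitian.eq, star_eq_conjTranspose, hB.inv.isHermitian.eq]
  have e : B⁻¹ * (B - C) = 1 - B⁻¹ * C := by rw [mul_sub, hBB]
  have e' : (B - C) * B⁻¹ = 1 - C * B⁻¹ := by rw [sub_mul, hBB']
  have e₁ : (1 - B⁻¹ * C) * C⁻¹ = C⁻¹ - B⁻¹ := by
    rw [sub_mul, Matrix.mul_assoc, hCC', one_mul, mul_one]
  have e₂ : C⁻¹ * (1 - C * B⁻¹) = C⁻¹ - B⁻¹ := by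
    rw [mul_sub, ← Matrix.mul_assoc, hCC, one_mul, mul_one]
  rw [e, e', e₁, sub_mul _ _ (1 - C * B⁻¹), e₂]
  noncomm_ring

/-- The unitaries with spectrum in the closed lower half circle parametrize the Cayley image of a
matrix interval, compatibly with coherency. -/
lemma exists_interval_parametrization {A B C : Mat2} (hA : A.IsHermitian)
    (hAC : (C - A).PosDef) (hCB : (B - C).PosDef) :
    ∃ e : U2 ≃ₜ U2, IsAut e ∧ (∀ n, e (spec n (-1) (-1)) = cayley A) ∧
      (∀ n, e (spec n 1 1) = cayley B) ∧
      (∀ n, e (spec n Circle.negI Circle.negI) = cayley C) ∧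
      ∀ n, ∀ z ∈ lowerArc, ∀ w ∈ lowerArc, ∃ X ∈ matIcc A B, e (spec n z w) = cayley X := by
  have hAB : (B - A).PosDef := by simpa using hCB.add hAC
  have hdiff := posDef_inv_sub_inv hAC (B := B - A) (by simpa using hCB)
  obtain ⟨T, hT, hTT⟩ := exists_invertible_mul_conjTranspose hdiff
  have hBu := (Matrix.isUnit_iff_isUnit_det _).1 hAB.isUnit
  have hCu := (Matrix.isUnit_iff_isUnit_det _).1 hAC.isUnit
  have hKB := nonsing_inv_mul _ hBu
  have hBK := mul_nonsing_inv _ hBu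
  have hCC := mul_nonsing_inv _ hCu
  have hK := hAB.inv
  obtain ⟨E, hTE⟩ : ∃ E : Mat2, Tᴴ * E = 1 :=
    ⟨(Tᴴ)⁻¹, mul_nonsing_inv _ (by rw [det_conjTranspose]; exact hT.star)⟩
  have hET : Eᴴ * T = 1 := by simpa using congrArg conjTranspose hTE
  have hEu : IsUnit E.det := isUnit_det_of_left_inverse hTE
  have hTeq : T = ((C - A)⁻¹ - (B - A)⁻¹) * E := by rw [← hTT, Matrix.mul_assoc, hTE, mul_one]
  generalize (B - A)⁻¹ = K at *
  generalize (C - A)⁻¹ = J at *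
  obtain ⟨D₁, hD₁⟩ : ∃ D₁, D₁ = Complex.I • (K * E) - T := ⟨_, rfl⟩
  obtain ⟨D₀, hD₀⟩ : ∃ D₀, D₀ = Complex.I • (K * E) + T := ⟨_, rfl⟩
  have hKH := hK.isHermitian.eq
  have h : IsPseudoUnitary _ _ _ _ := isPseudoUnitary_of_symplectic
    (N₁ := Complex.I • E + A * D₁) (N₀ := Complex.I • E + A * D₀) (D₁ := D₁) (D₀ := D₀)
    (by
      simp only [hD₁, conjTranspose_add, conjTranspose_sub, conjTranspose_smul, conjTranspose_mul,
        hKH, hA.eq, Complex.star_def, Complex.conj_I, add_mul, mul_add, sub_mul, mul_sub,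
        smul_mul_assoc, mul_smul_comm, Matrix.mul_assoc, hTE, hET]
      module)
    (by
      simp only [hD₁, hD₀, conjTranspose_add, conjTranspose_sub, conjTranspose_smul,
        conjTranspose_mul, hKH, hA.eq, Complex.star_def, Complex.conj_I, add_mul, mul_add, sub_mul,
        mul_sub, smul_mul_assoc, mul_smul_comm, Matrix.mul_assoc, hTE, hET]
      module)
    (by
      simp only [hD₀, conjTranspose_add, conjTranspose_smul, conjTranspose_mul,
        hKH, hA.eq, Complex.star_def, Complex.conj_I, add_mul, mul_add,
        smul_mul_assoc, mul_smul_comm, Matrix.mul_assoc, hTE, hET]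
      module)
  have hmap : ∀ (V : U2) (Y : Mat2),
      IsUnit (Complex.I • (K * E * (1 + (V : Mat2))) + T * (1 - (V : Mat2))).det →
      Y * (Complex.I • (K * E * (1 + (V : Mat2))) + T * (1 - (V : Mat2)))
        = Complex.I • (E * (1 + (V : Mat2))) → h.map V = cayley (Y + A) := by
    intro V Y hu hY
    have hmm := h.map_mul V
    generalize (h.map V : U2) = W at *
    have hD : D₁ * (V : Mat2) + D₀
        = Complex.I • (K * E * (1 + (V : Mat2))) + T * (1 - (V : Mat2)) := by
      rw [hD₁, hD₀]
      simp only [sub_mul, mul_add, mul_sub, smul_mul_assoc, mul_one]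
      module
    rw [← hD] at hu hY
    refine eq_cayley hu (N := Complex.I • (E * (1 + (V : Mat2))) + A * (D₁ * (V : Mat2) + D₀))
      (by rw [add_mul, hY]) ?_
    have e1 : (1 / 2 : ℂ) • (Complex.I • E + A * D₁ + Complex.I • D₁) * (V : Mat2)
        + (1 / 2 : ℂ) • (Complex.I • E + A * D₀ + Complex.I • D₀)
        = (1 / 2 : ℂ) • (Complex.I • (E * (1 + (V : Mat2))) + A * (D₁ * (V : Mat2) + D₀)
          + Complex.I • (D₁ * (V : Mat2) + D₀)) := by
      simp only [mul_add, add_mul, smul_mul_assoc, mul_one, Matrix.mul_assoc]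
      module
    have e2 : (1 / 2 : ℂ) • (Complex.I • E + A * D₁ - Complex.I • D₁) * (V : Mat2)
        + (1 / 2 : ℂ) • (Complex.I • E + A * D₀ - Complex.I • D₀)
        = (1 / 2 : ℂ) • (Complex.I • (E * (1 + (V : Mat2))) + A * (D₁ * (V : Mat2) + D₀)
          - Complex.I • (D₁ * (V : Mat2) + D₀)) := by
      simp only [mul_add, add_mul, sub_mul, smul_mul_assoc, mul_one, Matrix.mul_assoc]
      module
    rw [e1, e2, mul_smul_comm] at hmm
    exact smul_right_injective _ (by norm_num : (1 / 2 : ℂ) ≠ 0) hmm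
  refine ⟨h.homeomorph, h.isAut_map, fun n => ?_, fun n => ?_, fun n => ?_, ?_⟩
  · have hV : (spec n (-1) (-1) : Mat2) = (-1 : ℂ) • (1 : Mat2) := by
      rw [coe_spec, specMat_self, Circle.coe_neg, Circle.coe_one]
    have := hmap (spec n (-1) (-1)) 0
    rw [hV, zero_add] at this
    refine this ?_ (by simp)
    have e : Complex.I • (K * E * (1 + (-1 : ℂ) • (1 : Mat2))) + T * (1 - (-1 : ℂ) • (1 : Mat2))
        = (2 : ℂ) • T := by
      simp only [mul_add, mul_sub, mul_smul_comm, mul_one]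
      module
    rw [e, det_smul]
    exact (IsUnit.mk0 _ (by norm_num)).mul hT
  · have hV : (spec n 1 1 : Mat2) = 1 := by rw [spec_one_one]; rfl
    have := hmap (spec n 1 1) (B - A)
    rw [hV, sub_add_cancel] at this
    refine this ?_ ?_
    · have e : Complex.I • (K * E * (1 + 1)) + T * (1 - 1) = (2 * Complex.I) • (K * E) := by
        simp only [mul_add, mul_sub, mul_one]
        module
      rw [e, det_smul, det_mul]
      exact (IsUnit.mk0 _ (by simp)).mul ((isUnit_det_of_right_inverse hKB).mul hEu)
    · rw [sub_self, mul_zero, add_zero, mul_smul_comm, ← Matrix.mul_assoc, ← Matrix.mul_assoc,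
        hBK, one_mul]
  · have hV : (spec n Circle.negI Circle.negI : Mat2) = (-Complex.I) • (1 : Mat2) := by
      rw [coe_spec, specMat_self, Circle.coe_negI]
    have := hmap (spec n Circle.negI Circle.negI) (C - A)
    rw [hV, sub_add_cancel] at this
    have e : Complex.I • (K * E * (1 + (-Complex.I) • (1 : Mat2)))
        + T * (1 - (-Complex.I) • (1 : Mat2)) = (1 + Complex.I) • (J * E) := by
      rw [hTeq]
      simp only [mul_add, mul_sub, sub_mul, mul_smul_comm, mul_one]
      match_scalars
      · linear_combination -Complex.I_sq
      · ring
    have hne : (1 + Complex.I : ℂ) ≠ 0 := fun h0 => by simpa using congrArg Complex.re h0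
    rw [e] at this
    refine this ?_ ?_
    · rw [det_smul, det_mul]
      exact (IsUnit.mk0 _ (pow_ne_zero _ hne)).mul ((isUnit_det_of_left_inverse hCC).mul hEu)
    · rw [mul_smul_comm, ← Matrix.mul_assoc, hCC, one_mul]
      simp only [mul_add, mul_smul_comm, mul_one]
      match_scalars
      linear_combination Complex.I_sq
  · intro n z hz w hw
    obtain ⟨V, hV⟩ : ∃ V, V = spec n z w := ⟨_, rfl⟩
    have hVV : (V : Mat2)ᴴ * (V : Mat2) = 1 := Matrix.UnitaryGroup.star_mul_self V
    have hP : ((-Complex.I) • ((V : Mat2)ᴴ - (V : Mat2))).PosSemidef := by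
      have hp := posSemidef_specMat n (a := -2 * (z : ℂ).im) (b := -2 * (w : ℂ).im)
        (by linarith [show (z : ℂ).im ≤ 0 from hz]) (by linarith [show (w : ℂ).im ≤ 0 from hw])
      convert hp using 1
      have hc : ∀ u : ℂ, ((-2 * u.im : ℝ) : ℂ) = -Complex.I * (conj u - u) := by
        intro u
        apply Complex.ext <;> simp
        ring
      rw [hc, hc, hV, ← star_eq_conjTranspose, coe_spec, star_specMat]
      ext i j
      fin_cases i <;> fin_cases j <;> simp [specMat] <;> ring
    have key := exists_mul_eq_of_posSemidef (N := Complex.I • (E * (1 + (V : Mat2))))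
      (D := Complex.I • (K * E * (1 + (V : Mat2))) + T * (1 - (V : Mat2))) hAB.isHermitian hKB hK
      (by
        convert hP using 1
        have hETM : ∀ M : Mat2, Eᴴ * (T * M) = M := fun M => by rw [← Matrix.mul_assoc, hET, one_mul]
        simp only [conjTranspose_add, conjTranspose_smul, conjTranspose_mul,
          Complex.star_def, Complex.conj_I, add_mul, mul_add, mul_sub,
          smul_mul_assoc, mul_smul_comm, mul_one, Matrix.mul_assoc, hVV, hETM, hET]
        module)
      (by
        intro x hN hD
        rw [smul_mulVec, smul_eq_zero, or_iff_right Complex.I_ne_zero, ← mulVec_mulVec] at hN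
        have hF : (1 + (V : Mat2)) *ᵥ x = 0 := by
          have hx := mulVec_mulVec ((1 + (V : Mat2)) *ᵥ x) Tᴴ E
          rwa [hN, mulVec_zero, hTE, one_mulVec, eq_comm] at hx
        rw [add_mulVec, smul_mulVec, ← mulVec_mulVec, hF, mulVec_zero, smul_zero, zero_add,
          ← mulVec_mulVec] at hD
        have hG : (1 - (V : Mat2)) *ᵥ x = 0 := by
          have hx := mulVec_mulVec ((1 - (V : Mat2)) *ᵥ x) Eᴴ T
          rwa [hD, mulVec_zero, hET, one_mulVec, eq_comm] at hx
        rw [add_mulVec, one_mulVec] at hF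
        rw [sub_mulVec, one_mulVec] at hG
        have h2 : (2 : ℂ) • x = 0 := by
          rw [two_smul]
          calc x + x = (x + (V : Mat2) *ᵥ x) + (x - (V : Mat2) *ᵥ x) := by abel
            _ = 0 := by rw [hF, hG, add_zero]
        simpa using h2)
    obtain ⟨hu, Y, hY, hY0, hYB⟩ := key
    refine ⟨Y + A, ⟨by simpa using hY0, by rwa [add_comm, ← sub_sub]⟩, ?_⟩
    rw [← hV]
    exact hmap V Y hu hY

/-! ### Normalization of the values and conclusion -/

lemma IsPseudoUnitary.map_eq {α β γ δ : Mat2} (h : IsPseudoUnitary α β γ δ) {U W : U2}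
    (hW : (W : Mat2) * (γ * (U : Mat2) + δ) = α * (U : Mat2) + β) : h.map U = W := by
  have := (h.map_mul U).trans hW.symm
  have h1 := mul_nonsing_inv _ (h.isUnit_bot U)
  have h2 := congrArg (· * (γ * (U : Mat2) + δ)⁻¹) this
  simp only [Matrix.mul_assoc, h1, mul_one] at h2
  exact Subtype.ext h2

/-- An automorphism fixing `-1` and exchanging `1` and `-i`. -/
lemma exists_isAut_exchange : ∃ Λ : U2 → U2, IsAut Λ ∧
    (∀ n, Λ (spec n (-1) (-1)) = spec n (-1) (-1)) ∧
    (∀ n, Λ (spec n 1 1) = spec n Circle.negI Circle.negI) ∧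
    ∀ n, Λ (spec n Circle.negI Circle.negI) = spec n 1 1 := by
  have hII := Complex.I_sq
  have h : IsPseudoUnitary ((1 / 2 - Complex.I) • (1 : Mat2)) ((1 / 2 : ℂ) • (1 : Mat2))
      ((-1 / 2 : ℂ) • (1 : Mat2)) ((-1 / 2 - Complex.I) • (1 : Mat2)) := by
    refine ⟨?_, ?_, ?_⟩ <;>
    · simp only [conjTranspose_smul, conjTranspose_one, smul_mul_smul, mul_one, Complex.star_def,
        map_sub, map_div₀, map_neg, map_one, map_ofNat, Complex.conj_I]
      match_scalars
      first | ring1 | linear_combination -hII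
  have hmap : ∀ n (z w : Circle),
      (w : ℂ) * (-1 / 2 * z + (-1 / 2 - Complex.I)) = (1 / 2 - Complex.I) * z + 1 / 2 →
      (h.map (spec n z z))⁻¹ = spec n w⁻¹ w⁻¹ := by
    intro n z w hzw
    have : h.map (spec n z z) = spec n w w := h.map_eq (by
      simp only [coe_spec, specMat_self, smul_mul_smul, ← add_smul, mul_one, hzw])
    rw [this]
    apply Subtype.ext
    change star (spec n w w : Mat2) = _
    rw [coe_spec, coe_spec, star_specMat, Circle.coe_inv_eq_conj]
  refine ⟨_, isAut_inv.comp h.isAut_map, fun n => ?_, fun n => ?_, fun n => ?_⟩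
  · rw [Function.comp_apply, hmap n (-1) (-1)]
    · simp
    · simp only [Circle.coe_neg, Circle.coe_one]
      ring
  · have : Circle.negI = (Circle.negI⁻¹)⁻¹ := (inv_inv _).symm
    rw [Function.comp_apply, this, hmap n 1]
    rw [Circle.coe_inv_eq_conj, Circle.coe_negI, Circle.coe_one, map_neg, Complex.conj_I]
    linear_combination -hII
  · rw [Function.comp_apply, hmap n Circle.negI 1, inv_one]
    simp only [Circle.coe_negI, Circle.coe_one]
    linear_combination -hII

lemma exists_cay_eq {z : Circle} (hre : (z : ℂ).re < 0) (him : (z : ℂ).im < 0) :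
    ∃ t, 0 ≤ t ∧ t ≤ 1 ∧ z = cay t := by
  have hz : (z : ℂ).re ^ 2 + (z : ℂ).im ^ 2 = 1 := by
    have := z.normSq_coe
    rw [Complex.normSq_apply] at this
    linarith
  have hpos : 0 < 1 - (z : ℂ).re := by linarith
  refine ⟨-(z : ℂ).im / (1 - (z : ℂ).re), div_nonneg (by linarith) hpos.le, ?_, Circle.ext ?_⟩
  · rw [div_le_one hpos]
    nlinarith
  · rw [coe_cay, eq_div_iff (add_I_ne_zero _)]
    have ht : -(z : ℂ).im / (1 - (z : ℂ).re) * (1 - (z : ℂ).re) = -(z : ℂ).im :=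
      div_mul_cancel₀ _ hpos.ne'
    have ht' : (z : ℂ).im * (-(z : ℂ).im / (1 - (z : ℂ).re)) = -(1 + (z : ℂ).re) := by
      field_simp
      linarith
    generalize -(z : ℂ).im / (1 - (z : ℂ).re) = t at *
    apply Complex.ext <;> simp <;> linarith

/-- The unitaries with spectrum in the open third quadrant. -/
def quadrant : Set U2 := {V | (V : Mat2).trace.re < 0 ∧ (V : Mat2).trace.im < 0 ∧
  0 < ((V : Mat2) + star (V : Mat2)).det.re ∧ ((V : Mat2) - star (V : Mat2)).det.re < 0}

lemma isOpen_quadrant : IsOpen quadrant := by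
  have h1 : Continuous fun V : U2 => (V : Mat2).trace := continuous_subtype_val.matrix_trace
  have h2 : Continuous fun V : U2 => ((V : Mat2) + star (V : Mat2)).det :=
    (continuous_subtype_val.add continuous_subtype_val.star).matrix_det
  have h3 : Continuous fun V : U2 => ((V : Mat2) - star (V : Mat2)).det :=
    (continuous_subtype_val.sub continuous_subtype_val.star).matrix_det
  exact (isOpen_lt (Complex.continuous_re.comp h1) continuous_const).inter
    ((isOpen_lt (Complex.continuous_im.comp h1) continuous_const).inter
    ((isOpen_lt continuous_const (Complex.continuous_re.comp h2)).inter
    (isOpen_lt (Complex.continuous_re.comp h3) continuous_const)))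

lemma spec_mem_quadrant (n : S2) (z w : Circle) : spec n z w ∈ quadrant ↔
    ((z : ℂ).re < 0 ∧ (z : ℂ).im < 0) ∧ (w : ℂ).re < 0 ∧ (w : ℂ).im < 0 := by
  have hadd : (spec n z w : Mat2) + star (spec n z w : Mat2)
      = specMat n (z + conj (z : ℂ)) (w + conj (w : ℂ)) := by
    rw [coe_spec, star_specMat]
    ext i j
    fin_cases i <;> fin_cases j <;> simp [specMat] <;> ring
  have hsub : (spec n z w : Mat2) - star (spec n z w : Mat2)
      = specMat n (z - conj (z : ℂ)) (w - conj (w : ℂ)) := by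
    rw [coe_spec, star_specMat]
    ext i j
    fin_cases i <;> fin_cases j <;> simp [specMat] <;> ring
  simp only [quadrant, Set.mem_ofPred_eq]
  rw [hadd, hsub, coe_spec, (spec_trace_det _ _ _).1, (spec_trace_det _ _ _).2,
    (spec_trace_det _ _ _).2]
  simp only [Complex.add_re, Complex.add_im, Complex.mul_re, Complex.conj_re, Complex.conj_im,
    Complex.sub_re, Complex.sub_im]
  generalize (z : ℂ).re = a
  generalize (z : ℂ).im = b
  generalize (w : ℂ).re = c
  generalize (w : ℂ).im = d
  constructor
  · rintro ⟨h1, h2, h3, h4⟩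
    have h3' : 0 < a * c := by linarith
    have h4' : 0 < b * d := by linarith
    rcases mul_pos_iff.1 h3' with h | h <;> rcases mul_pos_iff.1 h4' with h' | h' <;>
      first | exact ⟨⟨h.1, h'.1⟩, h.2, h'.2⟩ | (exfalso; linarith)
  · rintro ⟨⟨h1, h2⟩, h3, h4⟩
    have := mul_pos_of_neg_of_neg h1 h3
    have := mul_pos_of_neg_of_neg h2 h4
    refine ⟨by linarith, by linarith, by linarith, by linarith⟩

lemma quadrant_nonempty : quadrant.Nonempty := by
  let z : Circle := Circle.mk (-(3 / 5) - 4 / 5 * Complex.I) (by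
    rw [Complex.norm_def, Complex.normSq_apply]
    norm_num)
  refine ⟨spec (S2.mk 0 0 1 (by norm_num)) z z, (spec_mem_quadrant _ _ _).2 ?_⟩
  have h1 : (z : ℂ).re < 0 := by
    change (-(3 / 5) - 4 / 5 * Complex.I : ℂ).re < 0
    norm_num
  have h2 : (z : ℂ).im < 0 := by
    change (-(3 / 5) - 4 / 5 * Complex.I : ℂ).im < 0
    norm_num
  exact ⟨⟨h1, h2⟩, h1, h2⟩

/-- **Theorem A.**  A coherency preserver on a connected open subset `𝒜 ⊆ U₂` containing the
Cayley image of a matrix interval `[A,B]` with `A < C < B`, whose values at `𝔠(A), 𝔠(C), 𝔠(B)`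
form a triple in a timelike position, is standard. -/
theorem theoremA
    (𝒜 : Set U2) (hopen : IsOpen 𝒜) (hconn : IsConnected 𝒜)
    (φ : U2 → U2)
    (hφ : ∀ U ∈ 𝒜, ∀ V ∈ 𝒜, CoherentU U V → CoherentU (φ U) (φ V))
    (A B C : Mat2) (hA : A.IsHermitian)
    (hAC : (C - A).PosDef) (hCB : (B - C).PosDef)
    (hsub : ∀ X ∈ matIcc A B, cayley X ∈ 𝒜)
    (htime : ∃ Ψ : U2 → U2, IsAut Ψ ∧
      ((Ψ (φ (cayley A)) : Mat2) = -(1 : Mat2)) ∧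
      ((Ψ (φ (cayley C)) : Mat2) = (1 : Mat2)) ∧
      ((Ψ (φ (cayley B)) : Mat2) = -(Complex.I • (1 : Mat2)))) :
    ∃ Φ : U2 → U2, IsAut Φ ∧ ∀ U ∈ 𝒜, Φ U = φ U := by
  obtain ⟨Ψ, hΨ, hΨA, hΨC, hΨB⟩ := htime
  obtain ⟨e, he, heA, heB, heC, heI⟩ := exists_interval_parametrization hA hAC hCB
  obtain ⟨Λ, hΛ, hΛm, hΛ1, hΛi⟩ := exists_isAut_exchange
  have hmem : ∀ n, ∀ z ∈ lowerArc, ∀ w ∈ lowerArc, e (spec n z w) ∈ 𝒜 := by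
    intro n z hz w hw
    obtain ⟨X, hX, hXe⟩ := heI n z hz w hw
    exact hXe ▸ hsub X hX
  have hΞ := hΛ.comp hΨ
  have hθ : IsNormalized (Λ ∘ Ψ ∘ φ ∘ e) := by
    refine ⟨fun n m z hz w hw u hu v hv hc => ?_, fun n => ?_, fun n => ?_, fun n => ?_⟩
    · exact (hΞ.2 _ _).1 (hφ _ (hmem n z hz w hw) _ (hmem m u hu v hv) ((he.2 _ _).1 hc))
    · have : Ψ (φ (cayley B)) = spec n Circle.negI Circle.negI := Subtype.ext (by
        rw [hΨB, coe_spec, specMat_self, Circle.coe_negI, neg_smul])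
      simp only [Function.comp_apply]
      rw [heB, this, hΛi]
    · have : Ψ (φ (cayley A)) = spec n (-1) (-1) := Subtype.ext (by
        rw [hΨA, coe_spec, specMat_self, Circle.coe_neg, Circle.coe_one, neg_smul, one_smul])
      simp only [Function.comp_apply]
      rw [heA, this, hΛm]
    · have : Ψ (φ (cayley C)) = spec n 1 1 := Subtype.ext (by
        rw [hΨC, spec_one_one]
        rfl)
      simp only [Function.comp_apply]
      rw [heC, this, hΛ1]
  obtain ⟨f, hf, hov, hfθ⟩ := hθ.exists_isometry
  obtain ⟨Φ₀, hΦ₀, hΦf⟩ := exists_isAut_of_isometry hf hov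
  obtain ⟨Φ₀', hl₀, -⟩ := Function.bijective_iff_has_inverse.1 hΦ₀.1
  have hΦ' : IsAut (e ∘ Φ₀' ∘ Λ ∘ Ψ) := he.comp ((hΦ₀.of_leftInverse hl₀).comp hΞ)
  obtain ⟨Φ, hl, hr⟩ := Function.bijective_iff_has_inverse.1 hΦ'.1
  refine ⟨Φ, hΦ'.of_leftInverse hl, fun U hU => ?_⟩
  have hquad : ∀ V ∈ quadrant, e V ∈ 𝒜 ∧ (e ∘ Φ₀' ∘ Λ ∘ Ψ) (φ (e V)) = e V := by
    intro V hV
    obtain ⟨n, z, w, rfl⟩ := exists_spec V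
    obtain ⟨⟨hz, hz'⟩, hw, hw'⟩ := (spec_mem_quadrant n z w).1 hV
    obtain ⟨s, hs0, hs1, rfl⟩ := exists_cay_eq hz hz'
    obtain ⟨t, ht0, ht1, rfl⟩ := exists_cay_eq hw hw'
    refine ⟨hmem _ _ hz'.le _ hw'.le, ?_⟩
    have h := hfθ n s t hs0 hs1 ht0 ht1
    rw [← hΦf] at h
    simp only [Function.comp_apply] at h ⊢
    rw [h, hl₀]
  have hfix := eq_self_of_eq_self_on_open (ψ := (e ∘ Φ₀' ∘ Λ ∘ Ψ) ∘ φ) hopen hconn.isPreconnected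
    (fun U hU V hV hc => (hΦ'.2 _ _).1 (hφ U hU V hV hc)) (e.isOpenMap _ isOpen_quadrant)
    (quadrant_nonempty.image e)
    (by
      rintro _ ⟨V, hV, rfl⟩
      exact (hquad V hV).1)
    (by
      rintro _ ⟨V, hV, rfl⟩
      exact (hquad V hV).2) U hU
  exact (congrArg Φ hfix).symm.trans (hl _)
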